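/- arXiv:2504.08335 — 2 statements merged into one kernel-verified Lean document; each statement's English description precedes it below -/
import Mathlib

section
/- Let Assumption (H) hold with E[‖A‖_HS^8] < ∞, and let E := {‖A−K‖_op ≤ λ(K)/2}. If ℙ(E) ≠ 0, then ∫_{ℝ^d} E[φ_A(x)1_E]·log( E[φ_A(x)1_E] / (ℙ(E)·φ_K(x)) ) dx ≤ (√3/(12√2))·(2√6+3√2+2+√d)·‖K^{-1}‖_HS^2·‖E[A]−K‖_HS^2 + { (√2/(λ(K)^4√3))·(2√6+3√2+2+√d)·‖K^{-1}‖_HS^2·(λ(K)^2+4‖K‖_HS^2) + (√70·d^2/λ(K)^4)·( (1/2)·max{ |log(2^d det K/(2‖K‖_op+λ(K))^d)|, log(2^d det K/λ(K)^d) } + (√2+1)d/4 ) + (3 + √3/8 + 5√10 + 4√30/3 + √15/3 + 10√5/3)·d^2/λ(K)^4 }·E[‖A−K‖_HS^8]^{1/2}. -/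
open MeasureTheory ProbabilityTheory Matrix

noncomputable section

/-- Euclidean norm on `Fin d → ℝ`. -/
def euclNorm {d : ℕ} (x : Fin d → ℝ) : ℝ := Real.sqrt (∑ i, x i ^ 2)

/-- Hilbert–Schmidt norm of a matrix. -/
def hsNorm {d : ℕ} (M : Matrix (Fin d) (Fin d) ℝ) : ℝ := Real.sqrt (∑ i, ∑ j, M i j ^ 2)

/-- Operator norm of a matrix (w.r.t. the Euclidean norm). -/
def opNorm {d : ℕ} (M : Matrix (Fin d) (Fin d) ℝ) : ℝ :=
  sSup {r : ℝ | ∃ x : Fin d → ℝ, euclNorm x = 1 ∧ r = euclNorm (M.mulVec x)}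

/-- Smallest eigenvalue of a symmetric matrix (as the infimum of the Rayleigh quotient). -/
def lambdaMin {d : ℕ} (M : Matrix (Fin d) (Fin d) ℝ) : ℝ :=
  sInf {r : ℝ | ∃ x : Fin d → ℝ, euclNorm x = 1 ∧ r = x ⬝ᵥ M.mulVec x}

/-- Density of the centered Gaussian law `N_d(0, M)` on `ℝ^d`. -/
def gaussDensity {d : ℕ} (M : Matrix (Fin d) (Fin d) ℝ) (x : Fin d → ℝ) : ℝ :=
  (Real.sqrt ((2 * Real.pi) ^ d * M.det))⁻¹ * Real.exp (-(1/2) * (x ⬝ᵥ M⁻¹.mulVec x))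

/-- The centered Gaussian law `N_d(0, M)` on `ℝ^d` (for `M` positive definite). -/
def gaussLaw {d : ℕ} (M : Matrix (Fin d) (Fin d) ℝ) : Measure (Fin d → ℝ) :=
  volume.withDensity fun x => ENNReal.ofReal (gaussDensity M x)

/-- Relative entropy (Kullback–Leibler divergence) of `μ` with respect to `ν`. -/
def relEnt {E : Type*} [MeasurableSpace E] (μ ν : Measure E) : ℝ :=
  ∫ x, Real.log ((μ.rnDeriv ν x).toReal) ∂μ

/-- `F` is a centered, integrable random vector which is conditionally Gaussian with respect to
the σ-field `𝓕`, with conditional covariance matrix `A`. -/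
def CondGaussian {Ω : Type*} [MeasurableSpace Ω] (P : Measure Ω) {d : ℕ}
    (F : Ω → Fin d → ℝ) (𝓕 : MeasurableSpace Ω)
    (A : Ω → Matrix (Fin d) (Fin d) ℝ) : Prop :=
  Integrable F P ∧ (∫ ω, F ω ∂P) = 0 ∧
  (∀ ω, (A ω).PosSemidef) ∧
  Measurable[𝓕] (fun ω i j => A ω i j) ∧
  ∀ y : Fin d → ℝ,
    P[(fun ω => Complex.exp (Complex.I * ((y ⬝ᵥ F ω : ℝ) : ℂ))) | 𝓕] =ᵐ[P]
      fun ω => ((Real.exp (-(1/2) * (y ⬝ᵥ (A ω).mulVec y)) : ℝ) : ℂ)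

/-- The dimensional constant `2√6 + 3√2 + 2 + √d`. -/
def Cfac (d : ℕ) : ℝ := 2 * Real.sqrt 6 + 3 * Real.sqrt 2 + 2 + Real.sqrt d

/-- `max{ |log(2^d det K/(2‖K‖_op + λ(K))^d)| , log(2^d det K/λ(K)^d) }`. -/
def maxLog {d : ℕ} (K : Matrix (Fin d) (Fin d) ℝ) : ℝ :=
  max |Real.log ((2 ^ d * K.det) / ((2 * opNorm K + lambdaMin K) ^ d))|
      (Real.log ((2 ^ d * K.det) / (lambdaMin K ^ d)))


/-- The event `E = {‖A − K‖_op ≤ λ(K)/2}`. -/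
def EvSet {Ω : Type*} {d : ℕ} (A : Ω → Matrix (Fin d) (Fin d) ℝ)
    (K : Matrix (Fin d) (Fin d) ℝ) : Set Ω :=
  {ω | opNorm (A ω - K) ≤ lambdaMin K / 2}

end


lemma aux_factor {d : ℕ} {M : Matrix (Fin d) (Fin d) ℝ} (hM : M.PosDef) :
    ∃ B : Matrix (Fin d) (Fin d) ℝ, M = Bᵀ * B ∧ B.det ≠ 0 := by
  have hH := hM.isHermitian
  let U : Matrix (Fin d) (Fin d) ℝ := hH.eigenvectorUnitary
  have hM' : M = U * diagonal hH.eigenvalues * Uᵀ := by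
    have := hH.spectral_theorem
    rw [Unitary.conjStarAlgAut_apply] at this
    simpa [U, Matrix.star_eq_conjTranspose, Matrix.conjTranspose_eq_transpose_of_trivial] using this
  refine ⟨diagonal (fun i => Real.sqrt (hH.eigenvalues i)) * Uᵀ, ?_, ?_⟩
  · have hdd : (diagonal hH.eigenvalues : Matrix (Fin d) (Fin d) ℝ) =
      diagonal (fun i => Real.sqrt (hH.eigenvalues i)) * diagonal (fun i => Real.sqrt (hH.eigenvalues i)) := by
      rw [diagonal_mul_diagonal]
      congr 1
      ext i
      exact (Real.mul_self_sqrt (hM.eigenvalues_pos i).le).symm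
    conv_lhs => rw [hM', hdd]
    simp only [transpose_mul, transpose_transpose, diagonal_transpose, Matrix.mul_assoc]
  · intro h0
    have h1 : M.det = 0 := by
      rw [hM']
      rw [det_mul, det_diagonal] at h0
      rcases mul_eq_zero.1 h0 with h | h
      · exfalso
        have : 0 < ∏ i, Real.sqrt (hH.eigenvalues i) :=
          Finset.prod_pos fun i _ => Real.sqrt_pos.2 (hM.eigenvalues_pos i)
        exact this.ne' h
      · rw [det_mul, h, mul_zero]
    exact hM.det_pos.ne' h1

lemma aux_log {q : ℝ} (h : q ≤ 1/2) : Real.exp (-q - q^2) ≤ 1 - q := by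
  have h1 : 0 < 1 - q := by linarith
  have h2 : 0 < 1 + q + q^2 := by nlinarith [sq_nonneg (q + 1/2)]
  have h3 : 1 + (q + q^2) ≤ Real.exp (q + q^2) := by linarith [Real.add_one_le_exp (q+q^2)]
  by_cases hq : 0 ≤ q
  · -- use exp(x) ≥ 1 + x + x^2/2
    have h4 : 1 + (q + q^2) + (q+q^2)^2/2 ≤ Real.exp (q + q^2) :=
      Real.quadratic_le_exp_of_nonneg (by positivity)
    rw [show -q - q^2 = -(q+q^2) by ring, Real.exp_neg]
    rw [inv_le_comm₀ (Real.exp_pos _) h1]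
    refine le_trans ?_ h4
    rw [inv_le_iff_one_le_mul₀ h1]
    nlinarith [mul_nonneg hq hq, mul_nonneg (mul_nonneg hq hq) (sub_nonneg.2 h), mul_nonneg (mul_nonneg (mul_nonneg hq hq) (sub_nonneg.2 h)) hq, mul_nonneg (mul_nonneg (mul_nonneg (mul_nonneg hq hq) (sub_nonneg.2 h)) hq) hq]
  · push Not at hq
    have h5 : 1 - q^2/2 * 0 ≤ 1 := by simp
    by_cases hq1 : q ≤ -1
    · have : Real.exp (-q - q^2) ≤ 1 := Real.exp_le_one_iff.2 (by nlinarith)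
      linarith
    · push Not at hq1
      rw [show -q - q^2 = -(q+q^2) by ring, Real.exp_neg]
      rw [inv_le_comm₀ (Real.exp_pos _) h1]
      refine le_trans ?_ h3
      rw [inv_le_iff_one_le_mul₀ h1]
      have : 0 ≤ (-q)^3 := pow_nonneg (by linarith) 3
      nlinarith

lemma aux_det {d : ℕ} {Q : Matrix (Fin d) (Fin d) ℝ} (hQ : Qᵀ = Q)
    (hb : ∀ x : Fin d → ℝ, x ⬝ᵥ Q *ᵥ x ≤ 1/2 * (x ⬝ᵥ x)) :
    Real.exp (-Q.trace - (Q * Q).trace) ≤ (1 - Q).det := by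
  have hH : Q.IsHermitian := by rw [IsHermitian, conjTranspose_eq_transpose_of_trivial, hQ]
  have h1 : (1 - Q).det = ∏ i, (1 - hH.eigenvalues i) := by
    have := Matrix.eval_charpoly Q 1
    rw [hH.charpoly_eq, Polynomial.eval_prod] at this
    simpa using this.symm
  have h2 : Q.trace = ∑ i, hH.eigenvalues i := by simpa using hH.trace_eq_sum_eigenvalues
  have h3 : (Q * Q).trace = ∑ i, hH.eigenvalues i ^ 2 := by
    let U : Matrix (Fin d) (Fin d) ℝ := hH.eigenvectorUnitary
    have hUU : Uᵀ * U = 1 := by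
      have := Unitary.coe_star_mul_self hH.eigenvectorUnitary
      simpa [U, Matrix.star_eq_conjTranspose, Matrix.conjTranspose_eq_transpose_of_trivial] using this
    have hM' : Q = U * diagonal hH.eigenvalues * Uᵀ := by
      have := hH.spectral_theorem
      rw [Unitary.conjStarAlgAut_apply] at this
      simpa [U, Matrix.star_eq_conjTranspose, Matrix.conjTranspose_eq_transpose_of_trivial] using this
    have : Q * Q = U * (diagonal hH.eigenvalues * diagonal hH.eigenvalues * Uᵀ) := by
      conv_lhs => rw [hM']
      calc _ = U * diagonal hH.eigenvalues * (Uᵀ * U) * diagonal hH.eigenvalues * Uᵀ := by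
            simp only [Matrix.mul_assoc]
        _ = _ := by rw [hUU]; simp only [Matrix.mul_assoc, Matrix.one_mul]
    rw [this, trace_mul_comm, Matrix.mul_assoc, hUU, Matrix.mul_one, diagonal_mul_diagonal, trace_diagonal]
    exact Finset.sum_congr rfl fun i _ => (sq _).symm
  have h4 : ∀ i, hH.eigenvalues i ≤ 1/2 := by
    intro i
    have := hH.eigenvalues_eq i
    have h := hb (hH.eigenvectorBasis i)
    simp only [star_trivial, RCLike.re_to_real] at this
    rw [← this] at h
    have hn : (⇑(hH.eigenvectorBasis i) : Fin d → ℝ) ⬝ᵥ (hH.eigenvectorBasis i) = 1 := by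
      have h1 := hH.eigenvectorBasis.orthonormal.1 i
      have h2 : inner ℝ (hH.eigenvectorBasis i) (hH.eigenvectorBasis i) = (1:ℝ) := by
        rw [real_inner_self_eq_norm_sq, h1]; norm_num
      rw [EuclideanSpace.inner_eq_star_dotProduct] at h2
      simpa using h2
    rw [hn] at h
    linarith
  rw [h1, h2, h3, ← Finset.sum_neg_distrib, ← Finset.sum_sub_distrib, Real.exp_sum]
  exact Finset.prod_le_prod (fun i _ => (Real.exp_pos _).le) fun i _ => aux_log (h4 i)

lemma aux_gauss {d : ℕ} {M : Matrix (Fin d) (Fin d) ℝ} (hM : M.PosDef) :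
    Integrable (fun x : Fin d → ℝ => Real.exp (-(1/2) * (x ⬝ᵥ M *ᵥ x))) ∧
    ∫ x : Fin d → ℝ, Real.exp (-(1/2) * (x ⬝ᵥ M *ᵥ x)) = Real.sqrt ((2 * Real.pi)^d / M.det) := by
  obtain ⟨B, hB, hdet⟩ := aux_factor hM
  have key := Real.map_matrix_volume_pi_eq_smul_volume_pi hdet
  let g : (Fin d → ℝ) → ℝ := fun y => ∏ i, Real.exp (-(1/2) * (y i)^2)
  have hfg : (fun x : Fin d → ℝ => Real.exp (-(1/2) * (x ⬝ᵥ M *ᵥ x))) = fun x => g (toLin' B x) := by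
    ext x
    simp only [g, toLin'_apply]
    rw [← Real.exp_sum, ← Finset.mul_sum, hB, ← mulVec_mulVec, dotProduct_mulVec, vecMul_transpose]
    simp only [dotProduct, sq]
  have hg1 : Integrable g := Integrable.fintype_prod (f := fun _ v => Real.exp (-(1/2) * v^2))
    fun i => integrable_exp_neg_mul_sq (by norm_num)
  have hcont : Continuous (toLin' B) := LinearMap.continuous_on_pi _
  have hg2 : ∫ y, g y = Real.sqrt (2 * Real.pi) ^ d := by
    have := integral_fintype_prod_volume_eq_pow (ι := Fin d) (fun v : ℝ => Real.exp (-(1/2) * v^2))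
    simp only [g]
    rw [this, integral_gaussian, Fintype.card_fin]
    congr 2
    ring
  have hgc : Continuous g := by
    simp only [g]; fun_prop
  rw [hfg]
  constructor
  · have : Integrable g (Measure.map (toLin' B) volume) := by
      rw [key]
      exact hg1.smul_measure (by simp)
    exact (integrable_map_measure hgc.aestronglyMeasurable hcont.measurable.aemeasurable).1 this
  · rw [← integral_map hcont.measurable.aemeasurable hgc.aestronglyMeasurable (f := g), key,
      integral_smul_measure, hg2]
    rw [ENNReal.toReal_ofReal (abs_nonneg _), hB, det_mul, det_transpose, smul_eq_mul,
      Real.sqrt_div (by positivity), Real.sqrt_mul_self_eq_abs, abs_inv]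
    have : Real.sqrt ((2 * Real.pi)^d) = Real.sqrt (2 * Real.pi) ^ d := by
      rw [Real.sqrt_eq_iff_mul_self_eq_of_pos (by positivity)]
      rw [← mul_pow, Real.mul_self_sqrt (by positivity)]
    rw [this]
    field_simp


lemma eucl_sq {d : ℕ} (x : Fin d → ℝ) : euclNorm x ^ 2 = x ⬝ᵥ x := by
  rw [euclNorm, Real.sq_sqrt (Finset.sum_nonneg fun i _ => sq_nonneg _)]
  simp [dotProduct, sq]

lemma eucl_nonneg {d : ℕ} (x : Fin d → ℝ) : 0 ≤ euclNorm x := Real.sqrt_nonneg _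

lemma hs_nonneg {d : ℕ} (M : Matrix (Fin d) (Fin d) ℝ) : 0 ≤ hsNorm M := Real.sqrt_nonneg _

lemma hs_sq {d : ℕ} (M : Matrix (Fin d) (Fin d) ℝ) : hsNorm M ^ 2 = ∑ i, ∑ j, M i j ^ 2 :=
  Real.sq_sqrt (Finset.sum_nonneg fun _ _ => Finset.sum_nonneg fun _ _ => sq_nonneg _)

lemma hs_sq_trace {d : ℕ} (M : Matrix (Fin d) (Fin d) ℝ) : hsNorm M ^ 2 = (M * Mᵀ).trace := by
  rw [hs_sq]
  simp [trace, Matrix.mul_apply, sq]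

open scoped Matrix.Norms.Frobenius in
lemma hs_eq_norm {d : ℕ} (M : Matrix (Fin d) (Fin d) ℝ) : hsNorm M = ‖M‖ := by
  rw [frobenius_norm_def, hsNorm, Real.sqrt_eq_rpow]
  simp

lemma hs_mul {d : ℕ} (M N : Matrix (Fin d) (Fin d) ℝ) : hsNorm (M * N) ≤ hsNorm M * hsNorm N := by
  simp only [hs_eq_norm]; exact frobenius_norm_mul M N

open scoped Matrix.Norms.Frobenius in
lemma hs_add {d : ℕ} (M N : Matrix (Fin d) (Fin d) ℝ) : hsNorm (M + N) ≤ hsNorm M + hsNorm N := by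
  simp only [hs_eq_norm]; exact norm_add_le M N

open scoped Matrix.Norms.Frobenius in
lemma hs_sub {d : ℕ} (M N : Matrix (Fin d) (Fin d) ℝ) : hsNorm (M - N) ≤ hsNorm M + hsNorm N := by
  simp only [hs_eq_norm]; exact norm_sub_le M N

lemma hs_tr {d : ℕ} (M : Matrix (Fin d) (Fin d) ℝ) : hsNorm Mᵀ = hsNorm M := by
  simp only [hsNorm, transpose_apply]; rw [Finset.sum_comm]

lemma trace_le {d : ℕ} (M N : Matrix (Fin d) (Fin d) ℝ) : |(M * N).trace| ≤ hsNorm M * hsNorm N := by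
  apply abs_le_of_sq_le_sq _ (mul_nonneg (hs_nonneg _) (hs_nonneg _))
  rw [mul_pow, ← hs_tr N, hs_sq, hs_sq]
  have := Finset.sum_mul_sq_le_sq_mul_sq (Finset.univ : Finset (Fin d × Fin d))
    (fun p => M p.1 p.2) (fun p => N p.2 p.1)
  simp only [Fintype.sum_prod_type] at this
  simpa [trace, Matrix.mul_apply] using this

lemma dot_le {d : ℕ} (x y : Fin d → ℝ) : (x ⬝ᵥ y)^2 ≤ (x ⬝ᵥ x) * (y ⬝ᵥ y) := by
  have := Finset.sum_mul_sq_le_sq_mul_sq Finset.univ x y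
  simpa [dotProduct, sq] using this

lemma dot_self_nonneg {d : ℕ} (x : Fin d → ℝ) : 0 ≤ x ⬝ᵥ x := by
  rw [← eucl_sq]; positivity

lemma hs_mulVec {d : ℕ} (M : Matrix (Fin d) (Fin d) ℝ) (x : Fin d → ℝ) :
    (M *ᵥ x) ⬝ᵥ (M *ᵥ x) ≤ hsNorm M ^ 2 * (x ⬝ᵥ x) := by
  rw [hs_sq, Finset.sum_mul, dotProduct]
  apply Finset.sum_le_sum
  intro i _
  have := dot_le (M i) x
  simp only [mulVec]
  rw [← sq]
  refine this.trans (le_of_eq ?_)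
  congr 1
  simp [dotProduct, sq]

lemma hs_eucl {d : ℕ} (M : Matrix (Fin d) (Fin d) ℝ) (x : Fin d → ℝ) :
    euclNorm (M *ᵥ x) ≤ hsNorm M * euclNorm x := by
  apply le_of_sq_le_sq _ (mul_nonneg (hs_nonneg _) (eucl_nonneg _))
  rw [mul_pow, eucl_sq, eucl_sq]
  exact hs_mulVec M x

lemma exists_unit {d : ℕ} (hd : 1 ≤ d) : ∃ x : Fin d → ℝ, euclNorm x = 1 := by
  refine ⟨Pi.single ⟨0, hd⟩ 1, ?_⟩
  have := eucl_sq (Pi.single (⟨0, hd⟩ : Fin d) (1:ℝ))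
  simp at this
  rcases this with h | h
  · exact h
  · linarith [eucl_nonneg (Pi.single (⟨0, hd⟩ : Fin d) (1:ℝ))]

lemma op_le_iff {d : ℕ} (hd : 1 ≤ d) (M : Matrix (Fin d) (Fin d) ℝ) (r : ℝ) :
    opNorm M ≤ r ↔ ∀ x, euclNorm x = 1 → euclNorm (M *ᵥ x) ≤ r := by
  constructor
  · intro h x hx
    have hb : BddAbove {r : ℝ | ∃ x : Fin d → ℝ, euclNorm x = 1 ∧ r = euclNorm (M.mulVec x)} := ?_
    · exact le_trans (le_csSup hb ⟨x, hx, rfl⟩) h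
    refine ⟨hsNorm M, ?_⟩
    rintro _ ⟨y, hy, rfl⟩
    have := hs_eucl M y
    rwa [hy, mul_one] at this
  · intro h
    apply csSup_le
    · obtain ⟨x, hx⟩ := exists_unit hd
      exact ⟨_, x, hx, rfl⟩
    · rintro _ ⟨y, hy, rfl⟩
      exact h y hy

lemma op_le_hs {d : ℕ} (hd : 1 ≤ d) (M : Matrix (Fin d) (Fin d) ℝ) : opNorm M ≤ hsNorm M := by
  rw [op_le_iff hd]
  intro x hx
  have := hs_eucl M x
  rwa [hx, mul_one] at this

lemma eucl_smul {d : ℕ} (c : ℝ) (hc : 0 ≤ c) (x : Fin d → ℝ) : euclNorm (c • x) = c * euclNorm x := by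
  have h := eucl_sq (c • x)
  rw [smul_dotProduct, dotProduct_smul, ← eucl_sq, smul_eq_mul, smul_eq_mul, ← mul_assoc, ← sq, ← mul_pow] at h
  exact (pow_left_inj₀ (eucl_nonneg _) (mul_nonneg hc (eucl_nonneg _)) two_ne_zero).1 h

lemma eucl_pos {d : ℕ} {x : Fin d → ℝ} (hx : x ≠ 0) : 0 < euclNorm x := by
  have h : 0 < x ⬝ᵥ x := lt_of_le_of_ne (dot_self_nonneg x) fun h => hx (dotProduct_self_eq_zero.1 h.symm)
  rw [← eucl_sq] at h
  rcases (eucl_nonneg x).eq_or_lt with h' | h'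
  · rw [← h'] at h; norm_num at h
  · exact h'

lemma eucl_normalize {d : ℕ} {x : Fin d → ℝ} (hx : x ≠ 0) :
    euclNorm ((euclNorm x)⁻¹ • x) = 1 := by
  rw [eucl_smul _ (inv_nonneg.2 (eucl_nonneg x)), inv_mul_cancel₀ (eucl_pos hx).ne']

lemma op_quad {d : ℕ} (hd : 1 ≤ d) {D : Matrix (Fin d) (Fin d) ℝ} {r : ℝ} (h : opNorm D ≤ r)
    (x : Fin d → ℝ) : |x ⬝ᵥ D *ᵥ x| ≤ r * (x ⬝ᵥ x) := by
  by_cases hx : x = 0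
  · simp [hx]
  have h1 := (op_le_iff hd D r).1 h _ (eucl_normalize hx)
  rw [mulVec_smul, eucl_smul _ (inv_nonneg.2 (eucl_nonneg x)), inv_mul_le_iff₀ (eucl_pos hx)] at h1
  have hr : 0 ≤ euclNorm x * r := (eucl_nonneg _).trans h1
  have h2 : (D *ᵥ x) ⬝ᵥ (D *ᵥ x) ≤ (euclNorm x * r)^2 := by
    rw [← eucl_sq]; exact pow_le_pow_left₀ (eucl_nonneg _) h1 2
  rw [← eucl_sq x]
  have e : r * euclNorm x ^ 2 = (euclNorm x * r) * euclNorm x := by ring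
  rw [e]
  apply abs_le_of_sq_le_sq _ (mul_nonneg hr (eucl_nonneg _))
  refine (dot_le x _).trans ?_
  rw [mul_pow, eucl_sq x, mul_comm]
  exact mul_le_mul_of_nonneg_right h2 (dot_self_nonneg x)

lemma pd_quad {d : ℕ} {K : Matrix (Fin d) (Fin d) ℝ} (hK : K.PosDef) {x : Fin d → ℝ} (hx : x ≠ 0) :
    0 < x ⬝ᵥ K *ᵥ x := by
  have := hK.dotProduct_mulVec_pos hx
  simpa using this

lemma psd_quad {d : ℕ} {K : Matrix (Fin d) (Fin d) ℝ} (hK : K.PosSemidef) (x : Fin d → ℝ) :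
    0 ≤ x ⬝ᵥ K *ᵥ x := by
  have := hK.dotProduct_mulVec_nonneg x
  simpa using this

lemma eucl_cont {d : ℕ} : Continuous (euclNorm : (Fin d → ℝ) → ℝ) := by
  unfold euclNorm; fun_prop

lemma lam_pos {d : ℕ} (hd : 1 ≤ d) {K : Matrix (Fin d) (Fin d) ℝ} (hK : K.PosDef) :
    0 < lambdaMin K := by
  have hc : IsCompact {x : Fin d → ℝ | euclNorm x = 1} := by
    apply Metric.isCompact_of_isClosed_isBounded
    · exact isClosed_eq eucl_cont continuous_const
    · apply (Metric.isBounded_closedBall (x := (0 : Fin d → ℝ)) (r := 1)).subset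
      intro x hx
      rw [mem_closedBall_zero_iff, pi_norm_le_iff_of_nonneg zero_le_one]
      intro i
      rw [Real.norm_eq_abs]
      apply abs_le_of_sq_le_sq _ zero_le_one
      have h1 : euclNorm x = 1 := hx
      have h2 : euclNorm x ^ 2 = ∑ i, x i ^ 2 := Real.sq_sqrt (Finset.sum_nonneg fun i _ => sq_nonneg _)
      rw [← h1, h2]
      exact Finset.single_le_sum (f := fun i => x i ^ 2) (fun i _ => sq_nonneg _) (Finset.mem_univ i)
  have hset : {r : ℝ | ∃ x : Fin d → ℝ, euclNorm x = 1 ∧ r = x ⬝ᵥ K.mulVec x} =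
      (fun x : Fin d → ℝ => x ⬝ᵥ K.mulVec x) '' {x : Fin d → ℝ | euclNorm x = 1} := by
    ext r
    simp only [Set.mem_ofPred_eq, Set.mem_image]
    constructor
    · rintro ⟨x, h, h'⟩; exact ⟨x, h, h'.symm⟩
    · rintro ⟨x, h, h'⟩; exact ⟨x, h, h'.symm⟩
  have hcont : Continuous (fun x : Fin d → ℝ => x ⬝ᵥ K.mulVec x) := by fun_prop
  have hne : Set.Nonempty {x : Fin d → ℝ | euclNorm x = 1} := exists_unit hd
  have hmem := (hc.image hcont).sInf_mem (hne.image _)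
  obtain ⟨x, hx, h⟩ := hmem
  rw [lambdaMin, hset, ← h]
  apply pd_quad hK
  rintro rfl
  have : euclNorm (0 : Fin d → ℝ) = 1 := hx
  simp [euclNorm] at this

lemma lam_le {d : ℕ} {K : Matrix (Fin d) (Fin d) ℝ} (hK : K.PosDef) (x : Fin d → ℝ) :
    lambdaMin K * (x ⬝ᵥ x) ≤ x ⬝ᵥ K *ᵥ x := by
  by_cases hx : x = 0
  · simp [hx]
  have h1 : lambdaMin K ≤ ((euclNorm x)⁻¹ • x) ⬝ᵥ K *ᵥ ((euclNorm x)⁻¹ • x) := by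
    apply csInf_le
    · refine ⟨0, ?_⟩
      rintro _ ⟨y, _, rfl⟩
      exact psd_quad hK.posSemidef y
    · exact ⟨_, eucl_normalize hx, rfl⟩
  rw [mulVec_smul, dotProduct_smul, smul_dotProduct, smul_eq_mul, smul_eq_mul, ← mul_assoc, ← mul_inv, ← sq,
    eucl_sq, le_inv_mul_iff₀' (by rw [← eucl_sq]; exact pow_pos (eucl_pos hx) 2)] at h1
  linarith

lemma inv_bound {d : ℕ} (hd : 1 ≤ d) {K : Matrix (Fin d) (Fin d) ℝ} (hK : K.PosDef) (v : Fin d → ℝ) :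
    lambdaMin K ^ 2 * ((K⁻¹ *ᵥ v) ⬝ᵥ (K⁻¹ *ᵥ v)) ≤ v ⬝ᵥ v := by
  set w := K⁻¹ *ᵥ v with hw
  have hv : v = K *ᵥ w := by
    rw [hw, mulVec_mulVec, mul_nonsing_inv _ (isUnit_iff_ne_zero.2 hK.det_pos.ne'), one_mulVec]
  have h1 := lam_le hK w
  rw [← hv] at h1
  have h2 := dot_le w v
  have hl := lam_pos hd hK
  have h3 := dot_self_nonneg w
  have h4 : (lambdaMin K * (w ⬝ᵥ w))^2 ≤ (w ⬝ᵥ w) * (v ⬝ᵥ v) :=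
    (pow_le_pow_left₀ (mul_nonneg hl.le h3) h1 2).trans h2
  rcases h3.eq_or_lt with h | h
  · rw [← h, mul_zero]; exact dot_self_nonneg v
  · have : (w ⬝ᵥ w) * (lambdaMin K ^ 2 * (w ⬝ᵥ w)) ≤ (w ⬝ᵥ w) * (v ⬝ᵥ v) := by
      calc _ = (lambdaMin K * (w ⬝ᵥ w))^2 := by ring
        _ ≤ _ := h4
    exact le_of_mul_le_mul_left this h

lemma hs_inv {d : ℕ} (hd : 1 ≤ d) {K : Matrix (Fin d) (Fin d) ℝ} (hK : K.PosDef)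
    (D : Matrix (Fin d) (Fin d) ℝ) : lambdaMin K ^ 2 * hsNorm (D * K⁻¹) ^ 2 ≤ hsNorm D ^ 2 := by
  rw [hs_sq, hs_sq, Finset.mul_sum]
  apply Finset.sum_le_sum
  intro i _
  have := inv_bound hd hK (D i)
  have hs : (K⁻¹)ᵀ = K⁻¹ := by
    have := hK.inv.isHermitian
    rwa [IsHermitian, conjTranspose_eq_transpose_of_trivial] at this
  have e : K⁻¹ *ᵥ (D i) = (D * K⁻¹) i := by
    rw [← hs, mulVec_transpose, hs]; rfl
  rw [e] at this
  simpa [dotProduct, sq] using this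

/-- bound of the whitened matrix -/
lemma hs_whiten {d : ℕ} {K R D : Matrix (Fin d) (Fin d) ℝ} (hR : K⁻¹ = Rᵀ * R) (hD : Dᵀ = D) :
    hsNorm (R * D * Rᵀ) ≤ hsNorm (D * K⁻¹) := by
  have h1 : hsNorm (R * D * Rᵀ) ^ 2 = ((D * K⁻¹) * (D * K⁻¹)).trace := by
    rw [hs_sq_trace, transpose_mul, transpose_mul, transpose_transpose, hD, hR]
    calc _ = (R * (D * Rᵀ * R * D * Rᵀ)).trace := by simp only [Matrix.mul_assoc]
      _ = ((D * Rᵀ * R * D * Rᵀ) * R).trace := trace_mul_comm _ _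
      _ = _ := by simp only [Matrix.mul_assoc]
  apply le_of_sq_le_sq _ (hs_nonneg _)
  rw [h1, sq]
  exact (le_abs_self _).trans (trace_le _ _)


section
variable {d : ℕ} {K A A' R : Matrix (Fin d) (Fin d) ℝ}

lemma pd_symm (hK : K.PosSemidef) : Kᵀ = K := by
  have := hK.isHermitian
  rwa [IsHermitian, conjTranspose_eq_transpose_of_trivial] at this

lemma quadE (hd : 1 ≤ d) (hK : K.PosDef) (h : opNorm (A - K) ≤ lambdaMin K / 2) (x : Fin d → ℝ) :
    |x ⬝ᵥ (A - K) *ᵥ x| ≤ 1/2 * (x ⬝ᵥ K *ᵥ x) := by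
  have h1 := op_quad hd h x
  have h2 := lam_le hK x
  linarith

lemma A_pd (hd : 1 ≤ d) (hK : K.PosDef) (hA : A.PosSemidef) (h : opNorm (A - K) ≤ lambdaMin K / 2) :
    A.PosDef := by
  apply PosDef.of_dotProduct_mulVec_pos hA.isHermitian
  intro x hx
  have h1 := quadE hd hK h x
  have h2 := pd_quad hK hx
  rw [sub_mulVec, dotProduct_sub] at h1
  have := (abs_le.1 h1).1
  simp only [star_trivial]
  linarith

lemma inv_quad (hA : A.PosDef) (x y : Fin d → ℝ) :
    2 * (x ⬝ᵥ y) - y ⬝ᵥ A *ᵥ y ≤ x ⬝ᵥ A⁻¹ *ᵥ x := by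
  have h := psd_quad hA.posSemidef (A⁻¹ *ᵥ x - y)
  have hx : A *ᵥ (A⁻¹ *ᵥ x) = x := by
    rw [mulVec_mulVec, mul_nonsing_inv _ (isUnit_iff_ne_zero.2 hA.det_pos.ne'), one_mulVec]
  have h2 : (A⁻¹ *ᵥ x) ⬝ᵥ A *ᵥ y = x ⬝ᵥ y := by
    rw [dotProduct_mulVec]
    conv_lhs => rw [← pd_symm hA.posSemidef]
    rw [vecMul_transpose, pd_symm hA.posSemidef, hx]
  rw [mulVec_sub, sub_dotProduct, dotProduct_sub, dotProduct_sub, hx, h2, dotProduct_comm y x,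
    dotProduct_comm (A⁻¹ *ᵥ x) x] at h
  linarith

lemma Ainv_quad (hd : 1 ≤ d) (hK : K.PosDef) (hA : A.PosSemidef)
    (h : opNorm (A - K) ≤ lambdaMin K / 2) (x : Fin d → ℝ) :
    2/3 * (x ⬝ᵥ K⁻¹ *ᵥ x) ≤ x ⬝ᵥ A⁻¹ *ᵥ x := by
  have h1 := inv_quad (A_pd hd hK hA h) x ((2/3 : ℝ) • (K⁻¹ *ᵥ x))
  have h2 := quadE hd hK h (K⁻¹ *ᵥ x)
  rw [sub_mulVec, dotProduct_sub] at h2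
  have hx : K *ᵥ (K⁻¹ *ᵥ x) = x := by
    rw [mulVec_mulVec, mul_nonsing_inv _ (isUnit_iff_ne_zero.2 hK.det_pos.ne'), one_mulVec]
  rw [hx, dotProduct_comm _ x] at h2
  rw [mulVec_smul, dotProduct_smul, dotProduct_smul, smul_dotProduct] at h1
  simp only [smul_eq_mul] at h1
  have := (abs_le.1 h2).2
  linarith

lemma M_pd (hd : 1 ≤ d) (hK : K.PosDef) (hA : A.PosSemidef)
    (h : opNorm (A - K) ≤ lambdaMin K / 2) (hA' : A'.PosSemidef)
    (h' : opNorm (A' - K) ≤ lambdaMin K / 2) : (A⁻¹ + A'⁻¹ - K⁻¹).PosDef := by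
  apply PosDef.of_dotProduct_mulVec_pos
  · exact (hA.inv.isHermitian.add hA'.inv.isHermitian).sub hK.inv.isHermitian
  intro x hx
  have h1 := Ainv_quad hd hK hA h x
  have h2 := Ainv_quad hd hK hA' h' x
  have h3 := pd_quad hK.inv hx
  simp only [star_trivial, sub_mulVec, add_mulVec, dotProduct_sub, dotProduct_add]
  linarith

lemma det_id (hK : K.PosDef) (hA : A.PosDef) (hA' : A'.PosDef) (hR : K⁻¹ = Rᵀ * R) :
    A.det * (A⁻¹ + A'⁻¹ - K⁻¹).det * A'.det * (K.det)⁻¹ =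
      (1 - (R * (A - K) * Rᵀ) * (R * (A' - K) * Rᵀ)).det := by
  have hu := (isUnit_iff_ne_zero.2 hK.det_pos.ne')
  have hua := (isUnit_iff_ne_zero.2 hA.det_pos.ne')
  have hua' := (isUnit_iff_ne_zero.2 hA'.det_pos.ne')
  have e1 : (R * (A - K) * Rᵀ) * (R * (A' - K) * Rᵀ) = R * ((A - K) * (Rᵀ * R) * (A' - K) * Rᵀ) := by
    simp only [Matrix.mul_assoc]
  have e2 : (A - K) * (Rᵀ * R) * (A' - K) * Rᵀ * R = (A - K) * K⁻¹ * (A' - K) * K⁻¹ := by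
    rw [hR]; simp only [Matrix.mul_assoc]
  rw [e1, det_one_sub_mul_comm, e2]
  have e3 : K.det⁻¹ = (K⁻¹).det := by rw [det_nonsing_inv, Ring.inverse_eq_inv']
  rw [e3, ← det_mul, ← det_mul, ← det_mul]
  congr 1
  have a1 : A * A⁻¹ = 1 := mul_nonsing_inv _ hua
  have a2 : A'⁻¹ * A' = 1 := nonsing_inv_mul _ hua'
  have a3 : K * K⁻¹ = 1 := mul_nonsing_inv _ hu
  have b1 : A * (A⁻¹ + A'⁻¹ - K⁻¹) * A' = A' + A - A * K⁻¹ * A' := by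
    rw [Matrix.mul_sub, Matrix.mul_add, a1, Matrix.sub_mul, Matrix.add_mul, Matrix.one_mul,
      Matrix.mul_assoc A, a2, Matrix.mul_one]
  rw [b1]
  simp only [Matrix.sub_mul, Matrix.mul_sub, Matrix.add_mul, a3, Matrix.one_mul]
  have : A * K⁻¹ * K * K⁻¹ = A * K⁻¹ := by
    rw [Matrix.mul_assoc _ K, a3, Matrix.mul_one]
  rw [this]
  abel

lemma gd_int (hA : A.PosDef) :
    Integrable (gaussDensity A) ∧ ∫ x, gaussDensity A x = 1 := by
  obtain ⟨h1, h2⟩ := aux_gauss hA.inv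
  constructor
  · exact h1.const_mul _
  · simp only [gaussDensity]
    rw [integral_const_mul, h2, det_nonsing_inv, Ring.inverse_eq_inv', div_inv_eq_mul]
    apply inv_mul_cancel₀
    have := hA.det_pos
    positivity

lemma gd_pos (hA : A.PosDef) (x : Fin d → ℝ) : 0 < gaussDensity A x := by
  have := hA.det_pos
  unfold gaussDensity
  positivity

lemma I_int (hd : 1 ≤ d) (hK : K.PosDef) (hR : K⁻¹ = Rᵀ * R) (hA : A.PosSemidef)
    (h : opNorm (A - K) ≤ lambdaMin K / 2) (hA' : A'.PosSemidef)
    (h' : opNorm (A' - K) ≤ lambdaMin K / 2) :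
    0 < (1 - (R * (A - K) * Rᵀ) * (R * (A' - K) * Rᵀ)).det ∧
    Integrable (fun x => gaussDensity A x * gaussDensity A' x / gaussDensity K x) ∧
    ∫ x, gaussDensity A x * gaussDensity A' x / gaussDensity K x =
      (Real.sqrt (1 - (R * (A - K) * Rᵀ) * (R * (A' - K) * Rᵀ)).det)⁻¹ := by
  have hM := M_pd hd hK hA h hA' h'
  have pA := A_pd hd hK hA h
  have pA' := A_pd hd hK hA' h'
  rw [← det_id hK pA pA' hR]
  obtain ⟨h1, h2⟩ := aux_gauss hM
  have k1 := hM.det_pos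
  have k2 := pA.det_pos
  have k3 := pA'.det_pos
  have k4 := hK.det_pos
  have e : (fun x => gaussDensity A x * gaussDensity A' x / gaussDensity K x) = fun x =>
      ((Real.sqrt ((2 * Real.pi) ^ d * A.det))⁻¹ * (Real.sqrt ((2 * Real.pi) ^ d * A'.det))⁻¹
        * Real.sqrt ((2 * Real.pi) ^ d * K.det)) *
      Real.exp (-(1/2) * (x ⬝ᵥ (A⁻¹ + A'⁻¹ - K⁻¹) *ᵥ x)) := by
    ext x
    simp only [gaussDensity]
    rw [sub_mulVec, add_mulVec, dotProduct_sub, dotProduct_add]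
    rw [show -(1/2 : ℝ) * (x ⬝ᵥ A⁻¹ *ᵥ x + x ⬝ᵥ A'⁻¹ *ᵥ x - x ⬝ᵥ K⁻¹ *ᵥ x) =
      -(1/2) * (x ⬝ᵥ A⁻¹ *ᵥ x) + -(1/2) * (x ⬝ᵥ A'⁻¹ *ᵥ x) - (-(1/2) * (x ⬝ᵥ K⁻¹ *ᵥ x)) by ring,
      Real.exp_sub, Real.exp_add]
    field_simp
  refine ⟨by positivity, ?_, ?_⟩
  · rw [e]; exact h1.const_mul _
  · rw [e, integral_const_mul, h2]
    have hp : (0:ℝ) < (2 * Real.pi)^d := by positivity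
    generalize (2 * Real.pi)^d = p at *
    generalize (A⁻¹ + A'⁻¹ - K⁻¹).det = m at *
    rw [← Real.sqrt_inv, ← Real.sqrt_inv, ← Real.sqrt_inv, ← Real.sqrt_mul (by positivity),
      ← Real.sqrt_mul (by positivity), ← Real.sqrt_mul (by positivity)]
    congr 1
    field_simp

lemma I_bound_large (hd : 1 ≤ d) (hK : K.PosDef) (hR : K⁻¹ = Rᵀ * R) (hA : A.PosSemidef)
    (h : opNorm (A - K) ≤ lambdaMin K / 2) :
    ∫ x, gaussDensity A x * gaussDensity A x / gaussDensity K x ≤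
      Real.exp (hsNorm (R * (A - K) * Rᵀ) ^ 2) := by
  obtain ⟨h0, -, h2⟩ := I_int hd hK hR hA h hA h
  rw [h2]
  set S := R * (A - K) * Rᵀ with hS
  have hD : (A - K)ᵀ = A - K := by rw [transpose_sub, pd_symm hA, pd_symm hK.posSemidef]
  have hSs : Sᵀ = S := by
    rw [hS, transpose_mul, transpose_mul, transpose_transpose, hD, Matrix.mul_assoc]
  have hRK : R * K * Rᵀ = 1 := by
    have hu := (isUnit_iff_ne_zero.2 hK.det_pos.ne')
    have a3 : Rᵀ * R * K = 1 := by rw [← hR]; exact nonsing_inv_mul _ hu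
    have a4 : R * K * Rᵀ = 1 := by
      rw [Matrix.mul_assoc] at a3
      exact mul_eq_one_comm.1 a3
    exact a4
  have hq : ∀ x : Fin d → ℝ, |x ⬝ᵥ S *ᵥ x| ≤ 1/2 * (x ⬝ᵥ x) := by
    intro x
    have key : ∀ B : Matrix (Fin d) (Fin d) ℝ, x ⬝ᵥ (R * B * Rᵀ) *ᵥ x = (Rᵀ *ᵥ x) ⬝ᵥ B *ᵥ (Rᵀ *ᵥ x) := by
      intro B
      rw [← mulVec_mulVec, ← mulVec_mulVec, dotProduct_mulVec x R, ← mulVec_transpose]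
    have := quadE hd hK h (Rᵀ *ᵥ x)
    rw [← key, ← key, hRK, one_mulVec] at this
    exact this
  have b1 := aux_det hSs (fun x => (abs_le.1 (hq x)).2)
  have b2 := aux_det (Q := -S) (by rw [transpose_neg, hSs]) (fun x => by
    rw [neg_mulVec, dotProduct_neg]; linarith [(abs_le.1 (hq x)).1])
  have e : (1 - S * S) = (1 - S) * (1 - -S) := by noncomm_ring
  have htr : (S * S).trace = hsNorm S ^ 2 := by rw [hs_sq_trace, hSs]
  have b3 : Real.exp (-(2 * hsNorm S ^ 2)) ≤ (1 - S * S).det := by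
    rw [e, det_mul]
    refine le_trans (le_of_eq ?_) (mul_le_mul b1 b2 (Real.exp_pos _).le ((Real.exp_pos _).le.trans b1))
    rw [← Real.exp_add, neg_mul_neg, trace_neg, htr]
    congr 1; ring
  rw [inv_le_comm₀ (Real.sqrt_pos.2 h0) (Real.exp_pos _), ← Real.exp_neg]
  apply Real.le_sqrt_of_sq_le
  refine le_trans (le_of_eq ?_) b3
  rw [← Real.exp_nat_mul]
  congr 1; push_cast; ring

lemma inv_sqrt_bound {S S' : Matrix (Fin d) (Fin d) ℝ}
    (hs : hsNorm S * hsNorm S' ≤ 1/4) (h0 : 0 < (1 - S * S').det) :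
    (Real.sqrt (1 - S * S').det)⁻¹ ≤ 1 + 1/2 * (S * S').trace + 2 * (hsNorm S ^ 2 * hsNorm S' ^ 2) := by
  set N := S * S' with hN
  set s := hsNorm S * hsNorm S' with hsdef
  have hs0 : 0 ≤ s := mul_nonneg (hs_nonneg _) (hs_nonneg _)
  have hNs : hsNorm N ≤ s := hs_mul S S'
  have hN0 := hs_nonneg N
  have htr : |N.trace| ≤ s := trace_le S S'
  clear_value N
  set Q := N + Nᵀ - N * Nᵀ with hQ
  have hQs : Qᵀ = Q := by
    rw [hQ, transpose_sub, transpose_add, transpose_mul, transpose_transpose, add_comm N]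
  have hNx : ∀ x : Fin d → ℝ, |x ⬝ᵥ N *ᵥ x| ≤ 1/4 * (x ⬝ᵥ x) := by
    intro x
    apply abs_le_of_sq_le_sq _ (by have := dot_self_nonneg x; positivity)
    have h1 := dot_le x (N *ᵥ x)
    have h2 := hs_mulVec N x
    have h3 := dot_self_nonneg x
    have h4 : hsNorm N ^ 2 ≤ (1/4)^2 := pow_le_pow_left₀ hN0 (hNs.trans hs) 2
    calc _ ≤ (x ⬝ᵥ x) * (hsNorm N ^ 2 * (x ⬝ᵥ x)) := h1.trans (mul_le_mul_of_nonneg_left h2 h3)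
      _ ≤ (x ⬝ᵥ x) * ((1/4)^2 * (x ⬝ᵥ x)) := by gcongr
      _ = _ := by ring
  have hb : ∀ x : Fin d → ℝ, x ⬝ᵥ Q *ᵥ x ≤ 1/2 * (x ⬝ᵥ x) := by
    intro x
    have h1 := (abs_le.1 (hNx x)).2
    have h2 : x ⬝ᵥ Nᵀ *ᵥ x = x ⬝ᵥ N *ᵥ x := by
      rw [dotProduct_mulVec, vecMul_transpose, dotProduct_comm]
    have h3 : x ⬝ᵥ (N * Nᵀ) *ᵥ x = (Nᵀ *ᵥ x) ⬝ᵥ (Nᵀ *ᵥ x) := by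
      rw [← mulVec_mulVec, dotProduct_mulVec, ← mulVec_transpose]
    have h4 := dot_self_nonneg (Nᵀ *ᵥ x)
    rw [hQ, sub_mulVec, add_mulVec, dotProduct_sub, dotProduct_add, h2, h3]
    linarith
  have hdet := aux_det hQs hb
  have e1 : (1 - Q) = (1 - N) * (1 - N)ᵀ := by
    rw [hQ, transpose_sub, transpose_one]; noncomm_ring
  have htrQ : Q.trace = 2 * N.trace - hsNorm N ^ 2 := by
    rw [hQ, trace_sub, trace_add, trace_transpose, hs_sq_trace]; ring
  have hQn : hsNorm Q ≤ 9/4 * s := by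
    have h1 : hsNorm Q ≤ hsNorm N + hsNorm N + hsNorm N * hsNorm N := by
      refine (hs_sub _ _).trans (add_le_add ((hs_add _ _).trans ?_) ((hs_mul _ _).trans ?_))
      · rw [hs_tr]
      · rw [hs_tr]
    nlinarith
  have htrQQ : (Q * Q).trace ≤ 81/16 * s ^ 2 := by
    have : (Q * Q).trace = hsNorm Q ^ 2 := by rw [hs_sq_trace, hQs]
    rw [this]
    calc hsNorm Q ^ 2 ≤ (9/4 * s)^2 := pow_le_pow_left₀ (hs_nonneg _) hQn 2
      _ = _ := by ring
  rw [e1, det_mul, det_transpose] at hdet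
  set t := (1 - N).det
  set u := 1/2 * N.trace + 81/64 * s^2 with hu
  have h1 : Real.exp (-(4 * u)) ≤ t * t := by
    refine le_trans (Real.exp_le_exp.2 ?_) hdet
    rw [hu, htrQ]
    nlinarith [sq_nonneg (hsNorm N)]
  have h2 : Real.exp (-(2 * u)) ≤ t := by
    apply le_of_sq_le_sq _ h0.le
    rw [sq t]
    refine le_trans (le_of_eq ?_) h1
    rw [← Real.exp_nat_mul]; congr 1; push_cast; ring
  have h3 : Real.exp (-u) ≤ Real.sqrt t := by
    apply Real.le_sqrt_of_sq_le
    refine le_trans (le_of_eq ?_) h2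
    rw [← Real.exp_nat_mul]; congr 1; push_cast; ring
  have h4 : (Real.sqrt t)⁻¹ ≤ Real.exp u := by
    rw [inv_le_comm₀ (Real.sqrt_pos.2 h0) (Real.exp_pos _), ← Real.exp_neg]; exact h3
  have hs2 : s^2 ≤ 1/4 * s := by nlinarith
  have hua : |u| ≤ 53/64 * s := by
    rw [abs_le] at htr ⊢
    constructor <;> nlinarith [htr.1, htr.2, sq_nonneg s]
  have h5 := (abs_le.1 (Real.abs_exp_sub_one_sub_id_le (x := u) (by linarith))).2
  have h6 : u^2 ≤ (53/64 * s)^2 := by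
    rw [← sq_abs u]; exact pow_le_pow_left₀ (abs_nonneg _) hua 2
  have e2 : hsNorm S ^ 2 * hsNorm S' ^ 2 = s^2 := by rw [hsdef]; ring
  rw [e2]
  nlinarith [sq_nonneg s]
end


lemma log_tangent {L : ℝ} (hL : 0 < L) {c : ℝ} (hc : 0 < c) : Real.log L ≤ Real.log c + L / c - 1 := by
  have h := Real.log_le_sub_one_of_pos (div_pos hL hc)
  rw [Real.log_div hL.ne' hc.ne'] at h
  linarith

lemma mix_int {Ω X : Type*} [MeasurableSpace Ω] [MeasurableSpace X] (ν : Measure X) [SFinite ν]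
    (μ : Measure Ω) [SFinite μ] (f : Ω → X → ℝ)
    (hf : Measurable (fun p : Ω × X => f p.1 p.2))
    (h : ∀ᵐ ω ∂μ, (∀ x, 0 ≤ f ω x) ∧ Integrable (f ω) ν) (B : Ω → ℝ) (hB : Integrable B μ)
    (h' : ∀ᵐ ω ∂μ, ∫ x, f ω x ∂ν ≤ B ω) :
    Integrable (fun p : Ω × X => f p.1 p.2) (μ.prod ν) := by
  rw [integrable_prod_iff hf.aestronglyMeasurable]
  refine ⟨h.mono fun ω hω => hω.2, ?_⟩
  refine hB.mono' ?_ ?_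
  · exact (hf.norm.stronglyMeasurable.integral_prod_right').aestronglyMeasurable
  · filter_upwards [h, h'] with ω h1 h2
    rw [Real.norm_of_nonneg (integral_nonneg fun x => norm_nonneg _)]
    refine le_trans (le_of_eq ?_) h2
    exact integral_congr_ae (Filter.Eventually.of_forall fun x => Real.norm_of_nonneg (h1.1 x))

lemma mix_pos {Ω : Type*} [MeasurableSpace Ω] {μ : Measure Ω} (hμ : μ ≠ 0) {u : Ω → ℝ}
    (hu : Integrable u μ) (h : ∀ᵐ ω ∂μ, 0 < u ω) : 0 < ∫ ω, u ω ∂μ := by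
  rw [integral_pos_iff_support_of_nonneg_ae (h.mono fun _ h => h.le) hu]
  have : Function.support u =ᵐ[μ] Set.univ := by
    filter_upwards [h] with ω hω
    exact propext ⟨fun _ => trivial, fun _ => hω.ne'⟩
  rw [measure_congr this]
  exact Measure.measure_univ_pos.2 hμ

lemma entropy_abs {Ω X : Type*} [MeasurableSpace Ω] [MeasurableSpace X] (ν : Measure X) [SFinite ν]
    (μ₁ μ₂ : Measure Ω) [IsFiniteMeasure μ₁] [IsFiniteMeasure μ₂]
    (f : Ω → X → ℝ) (φ : X → ℝ) (m : Ω → ℝ) (b : Ω × Ω → ℝ)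
    (hf : Measurable (fun p : Ω × X => f p.1 p.2)) (hφ : Measurable φ) (hφ0 : ∀ x, 0 < φ x)
    (hm : Measurable m) (hmi : Integrable m μ₂) (hb : Integrable b (μ₁.prod μ₁))
    (h1 : ∀ᵐ ω ∂μ₁, (∀ x, 0 < f ω x) ∧ Integrable (f ω) ν ∧ ∫ x, f ω x ∂ν = 1)
    (h2 : ∀ᵐ ω ∂μ₂, (∀ x, 0 < f ω x) ∧ Integrable (f ω) ν ∧ ∫ x, f ω x ∂ν = 1)
    (h22 : ∀ᵐ ω ∂μ₂, Integrable (fun x => f ω x * f ω x / φ x) ν ∧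
      ∫ x, f ω x * f ω x / φ x ∂ν ≤ Real.exp (m ω))
    (h12 : ∀ᵐ p ∂(μ₁.prod μ₁), Integrable (fun x => f p.1 x * f p.2 x / φ x) ν ∧
      ∫ x, f p.1 x * f p.2 x / φ x ∂ν ≤ b p)
    (g : X → ℝ) (hg : ∀ᵐ x ∂ν, g x = (∫ ω, f ω x ∂μ₁) + ∫ ω, f ω x ∂μ₂)
    (p : ℝ) (hp : p = μ₁.real Set.univ + μ₂.real Set.univ)
    (hF : Integrable (fun x => g x * Real.log (g x / (p * φ x))) ν) :
    ∫ x, g x * Real.log (g x / (p * φ x)) ∂ν ≤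
      (μ₁.real Set.univ)⁻¹ * (∫ q, b q ∂(μ₁.prod μ₁)) - μ₁.real Set.univ + ∫ ω, m ω ∂μ₂ := by
  set p₁ := μ₁.real Set.univ with hp1
  set p₂ := μ₂.real Set.univ with hp2
  have hp10 : 0 ≤ p₁ := measureReal_nonneg
  have hp20 : 0 ≤ p₂ := measureReal_nonneg
  -- joint integrability
  have J1 : Integrable (fun q : Ω × X => f q.1 q.2) (μ₁.prod ν) :=
    mix_int ν μ₁ f hf (h1.mono fun ω h => ⟨fun x => (h.1 x).le, h.2.1⟩) (fun _ => 1)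
      (integrable_const _) (h1.mono fun ω h => h.2.2.le)
  have J2 : Integrable (fun q : Ω × X => f q.1 q.2) (μ₂.prod ν) :=
    mix_int ν μ₂ f hf (h2.mono fun ω h => ⟨fun x => (h.1 x).le, h.2.1⟩) (fun _ => 1)
      (integrable_const _) (h2.mono fun ω h => h.2.2.le)
  have J3 : Integrable (fun q : Ω × X => |m q.1| * f q.1 q.2) (μ₂.prod ν) := by
    refine mix_int ν μ₂ (fun ω x => |m ω| * f ω x) ?_ ?_ (fun ω => |m ω|) hmi.abs ?_
    · exact ((hm.comp measurable_fst).abs).mul hf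
    · filter_upwards [h2] with ω h
      exact ⟨fun x => mul_nonneg (abs_nonneg _) (h.1 x).le, h.2.1.const_mul _⟩
    · filter_upwards [h2] with ω h
      rw [integral_const_mul, h.2.2, mul_one]
  have J3' : Integrable (fun q : Ω × X => m q.1 * f q.1 q.2) (μ₂.prod ν) := by
    refine J3.mono ((hm.comp measurable_fst).mul hf).aestronglyMeasurable ?_
    refine Filter.Eventually.of_forall fun q => ?_
    simp
  have J4 : Integrable (fun q : Ω × X => Real.exp (-m q.1) * (f q.1 q.2 * f q.1 q.2 / φ q.2)) (μ₂.prod ν) := by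
    refine mix_int ν μ₂ (fun ω x => Real.exp (-m ω) * (f ω x * f ω x / φ x)) ?_ ?_ (fun ω => 1)
      (integrable_const _) ?_
    · exact ((hm.comp measurable_fst).neg.exp).mul ((hf.mul hf).div (hφ.comp measurable_snd))
    · filter_upwards [h22] with ω h
      refine ⟨fun x => mul_nonneg (Real.exp_pos _).le (div_nonneg (mul_self_nonneg _) (hφ0 x).le), h.1.const_mul _⟩
    · filter_upwards [h22] with ω h
      rw [integral_const_mul]
      calc _ ≤ Real.exp (-m ω) * Real.exp (m ω) := mul_le_mul_of_nonneg_left h.2 (Real.exp_pos _).le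
        _ = 1 := by rw [← Real.exp_add]; simp
  have J5 : Integrable (fun q : (Ω × Ω) × X => f q.1.1 q.2 * f q.1.2 q.2 / φ q.2) ((μ₁.prod μ₁).prod ν) := by
    refine mix_int ν (μ₁.prod μ₁) (fun ω x => f ω.1 x * f ω.2 x / φ x) ?_ ?_ b hb
      (h12.mono fun q h => h.2)
    · have a1 : Measurable (fun q : (Ω × Ω) × X => f q.1.1 q.2) :=
        hf.comp ((measurable_fst.comp measurable_fst).prodMk measurable_snd)
      have a2 : Measurable (fun q : (Ω × Ω) × X => f q.1.2 q.2) :=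
        hf.comp ((measurable_snd.comp measurable_fst).prodMk measurable_snd)
      exact (a1.mul a2).div (hφ.comp measurable_snd)
    · have c1 : ∀ᵐ q ∂(μ₁.prod μ₁), ∀ x, 0 < f q.1 x :=
        Measure.quasiMeasurePreserving_fst.ae (h1.mono fun ω h => h.1)
      have c2 : ∀ᵐ q ∂(μ₁.prod μ₁), ∀ x, 0 < f q.2 x :=
        Measure.quasiMeasurePreserving_snd.ae (h1.mono fun ω h => h.1)
      filter_upwards [h12, c1, c2] with q h k1 k2
      exact ⟨fun x => div_nonneg (mul_nonneg (k1 x).le (k2 x).le) (hφ0 x).le, h.1⟩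
  set g₁ : X → ℝ := fun x => ∫ ω, f ω x ∂μ₁ with hg1
  set g₂ : X → ℝ := fun x => ∫ ω, f ω x ∂μ₂ with hg2
  let k : X → ℝ := fun x => ∫ ω, (m ω * f ω x - f ω x + Real.exp (-m ω) * (f ω x * f ω x / φ x)) ∂μ₂
  have J6 : Integrable (fun q : Ω × X => m q.1 * f q.1 q.2 - f q.1 q.2
      + Real.exp (-m q.1) * (f q.1 q.2 * f q.1 q.2 / φ q.2)) (μ₂.prod ν) := (J3'.sub J2).add J4
  -- pointwise inequality
  have hpt : ∀ᵐ x ∂ν, g x * Real.log (g x / (p * φ x)) ≤ p₁⁻¹ * (g₁ x * g₁ x / φ x) - g₁ x + k x := by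
    filter_upwards [hg, J1.prod_left_ae, J2.prod_left_ae, J6.prod_left_ae] with x hgx i1 i2 i6
    have hgx' : g x = g₁ x + g₂ x := hgx
    have hφx := hφ0 x
    have n1 : 0 ≤ g₁ x := integral_nonneg_of_ae (h1.mono fun ω h => (h.1 x).le)
    have n2 : 0 ≤ g₂ x := integral_nonneg_of_ae (h2.mono fun ω h => (h.1 x).le)
    have T1 : g₁ x * Real.log (g x / (p * φ x)) ≤
        p₁⁻¹ * (g₁ x * g₁ x / φ x) - 2 * g₁ x + g x * p₁ / p := by
      by_cases hμ : μ₁ = 0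
      · have e1 : g₁ x = 0 := by simp [hg1, hμ]
        have e2 : p₁ = 0 := by simp [hp1, hμ]
        simp [e1, e2]
      · have q1 : 0 < g₁ x := mix_pos hμ i1 (h1.mono fun ω h => h.1 x)
        have q2 : 0 < p₁ := by
          rw [hp1, measureReal_def]
          exact ENNReal.toReal_pos (Measure.measure_univ_pos.2 hμ).ne' (measure_ne_top _ _)
        have q3 : 0 < g x := by linarith
        have q4 : 0 < p := by linarith
        have hL : 0 < g x / (p * φ x) := by positivity
        have hc : 0 < g₁ x / (p₁ * φ x) := by positivity
        have t1 := log_tangent hL hc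
        have t2 := Real.log_le_sub_one_of_pos hc
        have t3 : Real.log (g x / (p * φ x)) ≤ g₁ x / (p₁ * φ x) - 2 + (g x / (p * φ x)) / (g₁ x / (p₁ * φ x)) := by
          linarith
        refine (mul_le_mul_of_nonneg_left t3 n1).trans (le_of_eq ?_)
        field_simp
    have T2 : g₂ x * Real.log (g x / (p * φ x)) ≤ k x + g x * p₂ / p - g₂ x := by
      by_cases hμ : μ₂ = 0
      · have e1 : g₂ x = 0 := by simp [hg2, hμ]
        have e2 : p₂ = 0 := by simp [hp2, hμ]
        have e3 : k x = 0 := by simp [k, hμ]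
        simp [e1, e2, e3]
      · have q1 : 0 < g₂ x := mix_pos hμ i2 (h2.mono fun ω h => h.1 x)
        have q2 : 0 < p₂ := by
          rw [hp2, measureReal_def]
          exact ENNReal.toReal_pos (Measure.measure_univ_pos.2 hμ).ne' (measure_ne_top _ _)
        have q3 : 0 < g x := by linarith
        have q4 : 0 < p := by linarith
        have hL : 0 < g x / (p * φ x) := by positivity
        have e1 : g₂ x * Real.log (g x / (p * φ x)) = ∫ ω, f ω x * Real.log (g x / (p * φ x)) ∂μ₂ := by
          rw [integral_mul_const]
        have i7 : Integrable (fun ω => m ω * f ω x - f ω x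
            + Real.exp (-m ω) * (f ω x * f ω x / φ x) + g x / p) μ₂ := i6.add (integrable_const _)
        have e2 : k x + g x * p₂ / p - g₂ x = ∫ ω, ((m ω * f ω x - f ω x
            + Real.exp (-m ω) * (f ω x * f ω x / φ x)) + g x / p - f ω x) ∂μ₂ := by
          rw [integral_sub i7 i2, integral_add i6 (integrable_const _),
            integral_const, smul_eq_mul, ← hp2]
          simp only [k, hg2]
          ring
        rw [e1, e2]
        refine integral_mono_ae (i2.mul_const _) (i7.sub i2) ?_
        filter_upwards [h2] with ω hω
        have fpos := hω.1 x
        have hc : 0 < f ω x / φ x := by positivity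
        have t1 := log_tangent hL hc
        have t2 := log_tangent hc (Real.exp_pos (m ω))
        rw [Real.log_exp] at t2
        have t3 : Real.log (g x / (p * φ x)) ≤ m ω - 2 + f ω x / φ x / Real.exp (m ω) + (g x / (p * φ x)) / (f ω x / φ x) := by
          linarith
        refine (mul_le_mul_of_nonneg_left t3 fpos.le).trans (le_of_eq ?_)
        rw [Real.exp_neg]
        have := Real.exp_pos (m ω)
        field_simp
        ring
    have T3 : g x * p₁ / p + g x * p₂ / p = g x := by
      by_cases hp0 : p = 0
      · have z1 : p₁ = 0 := by linarith
        have z2 : p₂ = 0 := by linarith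
        have m1 : μ₁ = 0 := by
          rw [← Measure.measure_univ_eq_zero]
          exact (measureReal_eq_zero_iff).1 z1
        have m2 : μ₂ = 0 := by
          rw [← Measure.measure_univ_eq_zero]
          exact (measureReal_eq_zero_iff).1 z2
        have : g x = 0 := by rw [hgx', hg1, hg2]; simp [m1, m2]
        simp [this]
      · rw [← add_div, ← mul_add, ← hp]
        field_simp
    have : g x * Real.log (g x / (p * φ x)) = g₁ x * Real.log (g x / (p * φ x)) + g₂ x * Real.log (g x / (p * φ x)) := by
      rw [← add_mul, ← hgx']
    rw [this]
    linarith
  -- integrability of the bound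
  have sqid : (fun x => g₁ x * g₁ x / φ x) = fun x => ∫ q : Ω × Ω, f q.1 x * f q.2 x / φ x ∂(μ₁.prod μ₁) := by
    ext x
    rw [integral_div, integral_prod_mul (fun ω => f ω x) (fun ω => f ω x)]
  have K1 : Integrable (fun x => g₁ x * g₁ x / φ x) ν := by
    rw [sqid]; exact J5.integral_prod_right
  have K2 : Integrable g₁ ν := J1.integral_prod_right
  have K3 : Integrable k ν := J6.integral_prod_right
  have I1 : ∫ x, g₁ x * g₁ x / φ x ∂ν ≤ ∫ q, b q ∂(μ₁.prod μ₁) := by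
    rw [sqid, ← integral_integral_swap (f := fun (q : Ω × Ω) x => f q.1 x * f q.2 x / φ x) J5]
    exact integral_mono_ae J5.integral_prod_left hb (h12.mono fun q h => h.2)
  have I2 : ∫ x, g₁ x ∂ν = p₁ := by
    rw [hg1, ← integral_integral_swap (f := f) J1]
    rw [integral_congr_ae (g := fun _ => (1:ℝ)) (h1.mono fun ω h => h.2.2)]
    simp [hp1]
  have I3 : ∫ x, k x ∂ν ≤ ∫ ω, m ω ∂μ₂ := by
    simp only [k]
    rw [← integral_integral_swap (f := fun ω x => m ω * f ω x - f ω x + Real.exp (-m ω) * (f ω x * f ω x / φ x)) J6]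
    refine integral_mono_ae J6.integral_prod_left hmi ?_
    filter_upwards [h2, h22] with ω a1 a2
    have a3 : Integrable (fun x => m ω * f ω x - f ω x) ν := (a1.2.1.const_mul _).sub a1.2.1
    rw [integral_add a3 (a2.1.const_mul _),
      integral_sub (a1.2.1.const_mul _) a1.2.1, integral_const_mul, integral_const_mul, a1.2.2]
    have : Real.exp (-m ω) * ∫ x, f ω x * f ω x / φ x ∂ν ≤ 1 := by
      calc _ ≤ Real.exp (-m ω) * Real.exp (m ω) := mul_le_mul_of_nonneg_left a2.2 (Real.exp_pos _).le
        _ = 1 := by rw [← Real.exp_add]; simp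
    linarith
  calc _ ≤ ∫ x, (p₁⁻¹ * (g₁ x * g₁ x / φ x) - g₁ x + k x) ∂ν :=
        integral_mono_ae hF (((K1.const_mul _).sub K2).add K3) hpt
    _ = p₁⁻¹ * (∫ x, g₁ x * g₁ x / φ x ∂ν) - p₁ + ∫ x, k x ∂ν := by
        have K12 : Integrable (fun x => p₁⁻¹ * (g₁ x * g₁ x / φ x) - g₁ x) ν := (K1.const_mul _).sub K2
        rw [integral_add K12 K3, integral_sub (K1.const_mul _) K2,
          integral_const_mul, I2]
    _ ≤ _ := by
        have := mul_le_mul_of_nonneg_left I1 (inv_nonneg.2 hp10)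
        linarith


lemma cs_int {Ω : Type*} [MeasurableSpace Ω] (μ : Measure Ω) [IsFiniteMeasure μ] (f : Ω → ℝ)
    (hf : Integrable f μ) (hf2 : Integrable (fun ω => f ω ^ 2) μ) :
    (∫ ω, f ω ∂μ) ^ 2 ≤ μ.real Set.univ * ∫ ω, f ω ^ 2 ∂μ := by
  set q := μ.real Set.univ with hq
  set I := ∫ ω, f ω ∂μ with hI
  set J := ∫ ω, f ω ^ 2 ∂μ with hJ
  have key : ∀ t : ℝ, 0 ≤ J - 2 * t * I + t ^ 2 * q := by
    intro t
    have h : 0 ≤ ∫ ω, (f ω ^ 2 - 2 * t * f ω + t ^ 2) ∂μ :=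
      integral_nonneg fun ω => by
        have : f ω ^ 2 - 2 * t * f ω + t ^ 2 = (f ω - t) ^ 2 := by ring
        simp only [Pi.zero_apply]
        rw [this]; positivity
    have j1 : Integrable (fun ω => f ω ^ 2 - 2 * t * f ω) μ := hf2.sub (hf.const_mul _)
    rw [integral_add j1 (integrable_const _), integral_sub hf2 (hf.const_mul _),
      integral_const_mul, integral_const, smul_eq_mul, ← hq] at h
    linarith
  have hq0 : 0 ≤ q := measureReal_nonneg
  rcases hq0.eq_or_lt with h0 | h0
  · have : μ = 0 := by
      rw [← Measure.measure_univ_eq_zero]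
      exact (measureReal_eq_zero_iff).1 h0.symm
    have : I = 0 := by simp [hI, this]
    rw [this, ← h0]; simp
  · have := key (I / q)
    have e : J - 2 * (I / q) * I + (I / q) ^ 2 * q = J - I ^ 2 / q := by field_simp; ring
    rw [e, sub_nonneg, div_le_iff₀ h0] at this
    linarith

lemma pow_int {Ω : Type*} [MeasurableSpace Ω] (μ : Measure Ω) [IsFiniteMeasure μ] (e f : Ω → ℝ)
    (he0 : ∀ ω, 0 ≤ e ω) {n : ℕ} (he : Integrable (fun ω => e ω ^ n) μ)
    (hf : Measurable f) (k : ℕ) (hk : k ≤ n) (h : ∀ ω, |f ω| ≤ e ω ^ k) : Integrable f μ := by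
  refine ((integrable_const (1:ℝ)).add he).mono' hf.aestronglyMeasurable (ae_of_all _ fun ω => ?_)
  rw [Real.norm_eq_abs]
  refine (h ω).trans ?_
  simp only [Pi.add_apply]
  rcases le_total (e ω) 1 with h1 | h1
  · have := pow_le_one₀ (n := k) (he0 ω) h1
    have := pow_nonneg (he0 ω) n
    linarith
  · have := pow_le_pow_right₀ h1 hk
    linarith

lemma entry_le {d : ℕ} (S : Matrix (Fin d) (Fin d) ℝ) (i j : Fin d) : |S i j| ≤ hsNorm S := by
  apply abs_le_of_sq_le_sq _ (hs_nonneg S)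
  rw [hs_sq]
  calc S i j ^ 2 ≤ ∑ j, S i j ^ 2 :=
        Finset.single_le_sum (f := fun j => S i j ^ 2) (fun _ _ => sq_nonneg _) (Finset.mem_univ j)
    _ ≤ _ := Finset.single_le_sum (f := fun i => ∑ j, S i j ^ 2)
        (fun _ _ => Finset.sum_nonneg fun _ _ => sq_nonneg _) (Finset.mem_univ i)

lemma hs_meas {Ω : Type*} [MeasurableSpace Ω] {d : ℕ} {S : Ω → Matrix (Fin d) (Fin d) ℝ}
    (hS : ∀ i j, Measurable fun ω => S ω i j) : Measurable fun ω => hsNorm (S ω) := by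
  unfold hsNorm
  exact (Finset.measurable_sum _ fun i _ => Finset.measurable_sum _ fun j _ => (hS i j).pow_const 2).sqrt

lemma cs_mat {Ω : Type*} [MeasurableSpace Ω] (μ : Measure Ω) [IsFiniteMeasure μ] {d : ℕ}
    (S : Ω → Matrix (Fin d) (Fin d) ℝ)
    (h1 : ∀ i j, Integrable (fun ω => S ω i j) μ) (h2 : ∀ i j, Integrable (fun ω => S ω i j ^ 2) μ) :
    ∑ i, ∑ j, (∫ ω, S ω i j ∂μ) ^ 2 ≤ μ.real Set.univ * ∫ ω, hsNorm (S ω) ^ 2 ∂μ := by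
  simp only [hs_sq]
  rw [integral_finsetSum _ fun i _ => integrable_finsetSum _ fun j _ => h2 i j, Finset.mul_sum]
  refine Finset.sum_le_sum fun i _ => ?_
  rw [integral_finsetSum _ fun j _ => h2 i j, Finset.mul_sum]
  exact Finset.sum_le_sum fun j _ => cs_int μ _ (h1 i j) (h2 i j)

lemma moment {Ω : Type*} [MeasurableSpace Ω] (P : Measure Ω) [IsProbabilityMeasure P] {d : ℕ}
    (S : Ω → Matrix (Fin d) (Fin d) ℝ) (e : Ω → ℝ) (hS : ∀ i j, Measurable fun ω => S ω i j)
    (hsym : ∀ ω, (S ω)ᵀ = S ω) (he : Measurable e) (hSe : ∀ ω, hsNorm (S ω) ≤ e ω)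
    (hV : Integrable (fun ω => e ω ^ 4) P) (E1 E2 : Set Ω) (hE1 : E1 = {ω | e ω ≤ 1/2})
    (hE2 : MeasurableSet E2) (h12 : E2 ⊆ E1ᶜ) :
    Integrable (fun p : Ω × Ω => 1 + 1/2 * (S p.1 * S p.2).trace
      + 2 * (hsNorm (S p.1) ^ 2 * hsNorm (S p.2) ^ 2)) ((P.restrict E1).prod (P.restrict E1)) ∧
    Integrable (fun ω => hsNorm (S ω) ^ 2) (P.restrict E2) ∧
    ((P.restrict E1).real Set.univ)⁻¹ * (∫ p : Ω × Ω, (1 + 1/2 * (S p.1 * S p.2).trace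
      + 2 * (hsNorm (S p.1) ^ 2 * hsNorm (S p.2) ^ 2)) ∂((P.restrict E1).prod (P.restrict E1)))
      - (P.restrict E1).real Set.univ + ∫ ω, hsNorm (S ω) ^ 2 ∂(P.restrict E2)
      ≤ 6/5 * hsNorm (Matrix.of fun i j => ∫ ω, S ω i j ∂P) ^ 2 + 30 * ∫ ω, e ω ^ 4 ∂P := by
  have mE1 : MeasurableSet E1 := by rw [hE1]; exact measurableSet_le he measurable_const
  have he0 : ∀ ω, 0 ≤ e ω := fun ω => (hs_nonneg _).trans (hSe ω)
  have hsm := hs_meas hS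
  have j1 : ∀ i j, Integrable (fun ω => S ω i j) P := fun i j =>
    pow_int P e _ he0 hV (hS i j) 1 (by norm_num) fun ω => by
      rw [pow_one]; exact (entry_le _ _ _).trans (hSe ω)
  have j2 : ∀ i j, Integrable (fun ω => S ω i j ^ 2) P := fun i j =>
    pow_int P e _ he0 hV ((hS i j).pow_const 2) 2 (by norm_num) fun ω => by
      rw [abs_pow]; exact pow_le_pow_left₀ (abs_nonneg _) ((entry_le _ _ _).trans (hSe ω)) 2
  have j3 : Integrable (fun ω => hsNorm (S ω) ^ 2) P :=
    pow_int P e _ he0 hV (hsm.pow_const 2) 2 (by norm_num) fun ω => by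
      rw [abs_pow, abs_of_nonneg (hs_nonneg _)]; exact pow_le_pow_left₀ (hs_nonneg _) (hSe ω) 2
  have j4 : Integrable (fun ω => (hsNorm (S ω) ^ 2) ^ 2) P :=
    pow_int P e _ he0 hV ((hsm.pow_const 2).pow_const 2) 4 (by norm_num) fun ω => by
      rw [← pow_mul, abs_pow, abs_of_nonneg (hs_nonneg _)]
      exact pow_le_pow_left₀ (hs_nonneg _) (hSe ω) 4
  set μ := P.restrict E1 with hμ
  have k1 : ∀ i j, Integrable (fun p : Ω × Ω => S p.1 i j * S p.2 j i) (μ.prod μ) := fun i j =>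
    ((j1 i j).restrict (s := E1)).mul_prod ((j1 j i).restrict (s := E1))
  have k2 : Integrable (fun p : Ω × Ω => (S p.1 * S p.2).trace) (μ.prod μ) := by
    simp only [trace, diag_apply, Matrix.mul_apply]
    exact integrable_finsetSum _ fun i _ => integrable_finsetSum _ fun j _ => k1 i j
  have k3 : Integrable (fun p : Ω × Ω => hsNorm (S p.1) ^ 2 * hsNorm (S p.2) ^ 2) (μ.prod μ) :=
    (j3.restrict (s := E1)).mul_prod (j3.restrict (s := E1))
  have k4 : Integrable (fun p : Ω × Ω => 1 + 1/2 * (S p.1 * S p.2).trace) (μ.prod μ) :=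
    (integrable_const _).add (k2.const_mul _)
  refine ⟨k4.add (k3.const_mul _), j3.restrict, ?_⟩
  set q := μ.real Set.univ with hq
  set V := ∫ ω, e ω ^ 4 ∂P with hVd
  set Q := ∫ ω, hsNorm (S ω) ^ 2 ∂μ with hQ
  set M2 := ∑ i, ∑ j, (∫ ω, S ω i j ∂μ) ^ 2 with hM2
  have hq0 : 0 ≤ q := measureReal_nonneg
  have hq1 : q ≤ 1 := by rw [hq, hμ, measureReal_restrict_apply_univ]; exact measureReal_le_one
  have b1 : ∫ p : Ω × Ω, (1 + 1/2 * (S p.1 * S p.2).trace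
      + 2 * (hsNorm (S p.1) ^ 2 * hsNorm (S p.2) ^ 2)) ∂(μ.prod μ) = q * q + 1/2 * M2 + 2 * (Q * Q) := by
    rw [integral_add k4 (k3.const_mul _), integral_add (integrable_const _) (k2.const_mul _),
      integral_const_mul, integral_const_mul,
      integral_prod_mul (μ := μ) (ν := μ) (fun ω => hsNorm (S ω) ^ 2) (fun ω => hsNorm (S ω) ^ 2),
      integral_const, smul_eq_mul, mul_one]
    congr 2
    · rw [← Set.univ_prod_univ, measureReal_prod_prod]
    · congr 1
      simp only [trace, diag_apply, Matrix.mul_apply]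
      rw [integral_finsetSum _ fun i _ => integrable_finsetSum _ fun j _ => k1 i j]
      refine Finset.sum_congr rfl fun i _ => ?_
      rw [integral_finsetSum _ fun j _ => k1 i j]
      refine Finset.sum_congr rfl fun j _ => ?_
      rw [integral_prod_mul (μ := μ) (ν := μ) (fun ω => S ω i j) (fun ω => S ω j i), sq]
      congr 1
      refine integral_congr_ae (ae_of_all _ fun ω => ?_)
      exact congrFun (congrFun (hsym ω) i) j
  have hQ2 : Q ^ 2 ≤ q * V := by
    refine (cs_int μ _ (j3.restrict (s := E1)) (j4.restrict (s := E1))).trans ?_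
    refine mul_le_mul_of_nonneg_left ?_ hq0
    calc ∫ ω, (hsNorm (S ω) ^ 2) ^ 2 ∂μ ≤ ∫ ω, (hsNorm (S ω) ^ 2) ^ 2 ∂P :=
          setIntegral_le_integral j4 (ae_of_all _ fun ω => by positivity)
      _ ≤ V := integral_mono j4 hV fun ω => by
          simp only [← pow_mul]
          exact pow_le_pow_left₀ (hs_nonneg _) (hSe ω) 4
  have hV0 : 0 ≤ V := integral_nonneg fun ω => by positivity
  have off : ∀ E : Set Ω, MeasurableSet E → E ⊆ E1ᶜ → ∫ ω in E, hsNorm (S ω) ^ 2 ∂P ≤ 4 * V := by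
    intro E mE hE
    calc ∫ ω in E, hsNorm (S ω) ^ 2 ∂P ≤ ∫ ω in E, 4 * e ω ^ 4 ∂P := by
          refine setIntegral_mono_on j3.integrableOn (hV.const_mul 4).integrableOn mE fun ω hω => ?_
          have h1 := hE hω
          rw [hE1] at h1
          simp only [Set.mem_compl_iff, Set.mem_ofPred_eq, not_le] at h1
          have h2 := pow_le_pow_left₀ (hs_nonneg _) (hSe ω) 2
          nlinarith [sq_nonneg (e ω), mul_nonneg (sq_nonneg (e ω)) (show 0 ≤ e ω ^ 2 - 1/4 by nlinarith)]
      _ ≤ ∫ ω, 4 * e ω ^ 4 ∂P := setIntegral_le_integral (hV.const_mul 4) (ae_of_all _ fun ω => by positivity)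
      _ = _ := integral_const_mul _ _
  have hM : q⁻¹ * (1/2 * M2) ≤ 6/5 * hsNorm (Matrix.of fun i j => ∫ ω, S ω i j ∂P) ^ 2 + 24 * V := by
    have hM0 : 0 ≤ M2 := Finset.sum_nonneg fun _ _ => Finset.sum_nonneg fun _ _ => sq_nonneg _
    have hB0 : 0 ≤ hsNorm (Matrix.of fun i j => ∫ ω, S ω i j ∂P) ^ 2 := by positivity
    by_cases hc : 1/2 ≤ q
    · have s1 : q⁻¹ * (1/2 * M2) ≤ M2 := by
        have : q⁻¹ ≤ 2 := by
          rw [inv_le_comm₀ (by linarith) two_pos]; linarith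
        nlinarith
      have s2 : ∑ i, ∑ j, (∫ ω in E1ᶜ, S ω i j ∂P) ^ 2 ≤ 4 * V := by
        refine (cs_mat (P.restrict E1ᶜ) S (fun i j => (j1 i j).restrict) (fun i j => (j2 i j).restrict)).trans ?_
        have o := off E1ᶜ mE1.compl le_rfl
        have o0 : 0 ≤ ∫ ω in E1ᶜ, hsNorm (S ω) ^ 2 ∂P := integral_nonneg fun ω => by positivity
        have r1 : (P.restrict E1ᶜ).real Set.univ ≤ 1 := by
          rw [measureReal_restrict_apply_univ]; exact measureReal_le_one
        nlinarith
      have s3 : M2 ≤ 6/5 * hsNorm (Matrix.of fun i j => ∫ ω, S ω i j ∂P) ^ 2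
          + 6 * ∑ i, ∑ j, (∫ ω in E1ᶜ, S ω i j ∂P) ^ 2 := by
        rw [hs_sq, Finset.mul_sum, Finset.mul_sum, ← Finset.sum_add_distrib]
        refine Finset.sum_le_sum fun i _ => ?_
        rw [Finset.mul_sum, Finset.mul_sum, ← Finset.sum_add_distrib]
        refine Finset.sum_le_sum fun j _ => ?_
        have := integral_add_compl mE1 (j1 i j)
        rw [Matrix.of_apply, ← this]
        nlinarith [sq_nonneg ((∫ ω in E1, S ω i j ∂P) + 6 * (∫ ω in E1ᶜ, S ω i j ∂P))]
      linarith
    · push Not at hc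
      have s1 := cs_mat μ S (fun i j => (j1 i j).restrict) (fun i j => (j2 i j).restrict)
      have s2 : q⁻¹ * (1/2 * M2) ≤ 1/2 * Q := by
        rcases hq0.eq_or_lt with h0 | h0
        · rw [← h0]; simp; exact integral_nonneg fun ω => by positivity
        · rw [inv_mul_le_iff₀ h0]; linarith
      have s3 : Q ≤ 1/4 * q := by
        calc Q ≤ ∫ ω in E1, (1/4 : ℝ) ∂P := by
              refine setIntegral_mono_on j3.integrableOn (integrable_const _).integrableOn mE1 fun ω hω => ?_
              rw [hE1] at hω
              have h1 : e ω ≤ 1/2 := hω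
              nlinarith [hs_nonneg (S ω), hSe ω]
          _ = _ := by rw [integral_const, smul_eq_mul, ← hμ, ← hq, mul_comm]
      have s4 : 1/16 * (1 - q) ≤ V := by
        have c1 : (P.restrict E1ᶜ).real Set.univ = 1 - q := by
          rw [measureReal_restrict_apply_univ, probReal_compl_eq_one_sub mE1, hq, hμ,
            measureReal_restrict_apply_univ]
        calc 1/16 * (1 - q) = ∫ ω in E1ᶜ, (1/16 : ℝ) ∂P := by
              rw [integral_const, smul_eq_mul, c1, mul_comm]
          _ ≤ ∫ ω in E1ᶜ, e ω ^ 4 ∂P := by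
              refine setIntegral_mono_on (integrable_const _).integrableOn hV.integrableOn mE1.compl fun ω hω => ?_
              rw [hE1] at hω
              simp only [Set.mem_compl_iff, Set.mem_ofPred_eq, not_le] at hω
              have := pow_le_pow_left₀ (by norm_num) hω.le 4
              norm_num at this ⊢
              linarith
          _ ≤ V := setIntegral_le_integral hV (ae_of_all _ fun ω => by positivity)
      linarith
  have hQV : q⁻¹ * (2 * (Q * Q)) ≤ 2 * V := by
    rcases hq0.eq_or_lt with h0 | h0
    · rw [← h0]; simp; exact hV0
    · rw [inv_mul_le_iff₀ h0]; nlinarith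
  have hqq : q⁻¹ * (q * q) = q := by
    rcases hq0.eq_or_lt with h0 | h0
    · rw [← h0]; simp
    · field_simp
  have o2 := off E2 hE2 h12
  rw [b1, mul_add, mul_add, hqq]
  linarith


lemma det_meas {Ω : Type*} [MeasurableSpace Ω] {d : ℕ} {M : Ω → Matrix (Fin d) (Fin d) ℝ}
    (h : ∀ i j, Measurable fun ω => M ω i j) : Measurable fun ω => (M ω).det := by
  simp only [det_apply']
  exact Finset.measurable_sum _ fun σ _ => (Finset.measurable_prod _ fun i _ => h _ _).const_mul _

lemma inv_meas {Ω : Type*} [MeasurableSpace Ω] {d : ℕ} {M : Ω → Matrix (Fin d) (Fin d) ℝ}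
    (h : ∀ i j, Measurable fun ω => M ω i j) (i j : Fin d) : Measurable fun ω => (M ω)⁻¹ i j := by
  simp only [inv_def, Ring.inverse_eq_inv', Matrix.smul_apply, smul_eq_mul, adjugate_apply]
  refine (det_meas h).inv.mul (det_meas fun a b => ?_)
  simp only [updateRow_apply]
  split_ifs
  · exact measurable_const
  · exact h a b

lemma gd_meas {Ω : Type*} [MeasurableSpace Ω] {d : ℕ} {M : Ω → Matrix (Fin d) (Fin d) ℝ}
    (h : ∀ i j, Measurable fun ω => M ω i j) {f : Ω → Fin d → ℝ} (hf : Measurable f) :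
    Measurable fun ω => gaussDensity (M ω) (f ω) := by
  unfold gaussDensity
  have hf' : ∀ i, Measurable fun ω => f ω i := fun i => (measurable_pi_apply i).comp hf
  refine (((det_meas h).const_mul _).sqrt.inv).mul (Measurable.exp (Measurable.const_mul ?_ _))
  simp only [dotProduct, mulVec]
  exact Finset.measurable_sum _ fun i _ => (hf' i).mul
    (Finset.measurable_sum _ fun j _ => (inv_meas h i j).mul (hf' j))

lemma ev_meas {Ω : Type*} [MeasurableSpace Ω] {d : ℕ} (hd : 1 ≤ d) {A : Ω → Matrix (Fin d) (Fin d) ℝ}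
    (K : Matrix (Fin d) (Fin d) ℝ)
    (h : Measurable fun ω i j => A ω i j) : MeasurableSet (EvSet A K) := by
  let T : Set (Fin d → Fin d → ℝ) :=
    ⋂ x ∈ {x : Fin d → ℝ | euclNorm x = 1},
      {M | euclNorm (fun i => ∑ j, (M i j - K i j) * x j) ≤ lambdaMin K / 2}
  have hT : IsClosed T := isClosed_biInter fun x _ =>
    isClosed_le (eucl_cont.comp (by fun_prop)) continuous_const
  have e : EvSet A K = (fun ω i j => A ω i j) ⁻¹' T := by
    ext ω
    simp only [EvSet, T, Set.mem_ofPred_eq, Set.mem_preimage, Set.mem_iInter, op_le_iff hd]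
    rfl
  rw [e]
  exact h hT.measurableSet

lemma const1 {d : ℕ} (hd : 1 ≤ d) : 6/5 ≤ (Real.sqrt 3 / (12 * Real.sqrt 2)) * Cfac d := by
  unfold Cfac
  have h6 : 2.44 ≤ Real.sqrt 6 := Real.le_sqrt_of_sq_le (by norm_num)
  have h2 : 1.414 ≤ Real.sqrt 2 := Real.le_sqrt_of_sq_le (by norm_num)
  have h2' : Real.sqrt 2 ≤ 1.415 := Real.sqrt_le_iff.2 ⟨by norm_num, by norm_num⟩
  have h3 : 1.732 ≤ Real.sqrt 3 := Real.le_sqrt_of_sq_le (by norm_num)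
  have hd' : 1 ≤ Real.sqrt d := Real.le_sqrt_of_sq_le (by norm_num; exact_mod_cast hd)
  have a : (12.12:ℝ) ≤ 2 * Real.sqrt 6 + 3 * Real.sqrt 2 + 2 + Real.sqrt d := by linarith
  have b : (0.1019:ℝ) ≤ Real.sqrt 3 / (12 * Real.sqrt 2) := by
    rw [le_div_iff₀ (by positivity)]; linarith
  nlinarith

lemma const2 {d : ℕ} (hd : 1 ≤ d) : 30 ≤ (3 + Real.sqrt 3 / 8 + 5 * Real.sqrt 10 + 4 * Real.sqrt 30 / 3
            + Real.sqrt 15 / 3 + 10 * Real.sqrt 5 / 3) * (d : ℝ) ^ 2 := by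
  have h3 : 0 ≤ Real.sqrt 3 := Real.sqrt_nonneg _
  have h10 : 3 ≤ Real.sqrt 10 := Real.le_sqrt_of_sq_le (by norm_num)
  have h30 : 5 ≤ Real.sqrt 30 := Real.le_sqrt_of_sq_le (by norm_num)
  have h15 : 3 ≤ Real.sqrt 15 := Real.le_sqrt_of_sq_le (by norm_num)
  have h5 : 2 ≤ Real.sqrt 5 := Real.le_sqrt_of_sq_le (by norm_num)
  have hd' : (1:ℝ) ≤ (d:ℝ)^2 := one_le_pow₀ (by exact_mod_cast hd)
  nlinarith

lemma final {d : ℕ} (hd : 1 ≤ d)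
    {Ω : Type*} [mΩ : MeasurableSpace Ω] (P : Measure Ω) [IsProbabilityMeasure P]
    (K : Matrix (Fin d) (Fin d) ℝ) (hK : K.PosDef)
    (A : Ω → Matrix (Fin d) (Fin d) ℝ)
    (hpsd : ∀ ω, (A ω).PosSemidef) (hAm : Measurable fun ω i j => A ω i j)
    (hA8 : Integrable (fun ω => hsNorm (A ω) ^ 8) P) :
    (∫ x : Fin d → ℝ,
        (∫ ω in EvSet A K, gaussDensity (A ω) x ∂P) *
          Real.log ((∫ ω in EvSet A K, gaussDensity (A ω) x ∂P) /
            ((P (EvSet A K)).toReal * gaussDensity K x))) ≤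
      6/5 * (hsNorm K⁻¹ ^ 2 *
        hsNorm ((Matrix.of fun i j => ∫ ω, A ω i j ∂P) - K) ^ 2)
      + 30 * (Real.sqrt (∫ ω, hsNorm (A ω - K) ^ 8 ∂P) / lambdaMin K ^ 4) := by
  by_cases hF : Integrable (fun x : Fin d → ℝ => (∫ ω in EvSet A K, gaussDensity (A ω) x ∂P) *
          Real.log ((∫ ω in EvSet A K, gaussDensity (A ω) x ∂P) /
            ((P (EvSet A K)).toReal * gaussDensity K x)))
  swap
  · rw [integral_undef hF]
    positivity
  have hl := lam_pos hd hK
  obtain ⟨R, hR, -⟩ := aux_factor hK.inv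
  have mA : ∀ i j, Measurable fun ω => A ω i j := fun i j =>
    (measurable_pi_apply j).comp ((measurable_pi_apply i).comp hAm)
  have mD : ∀ i j, Measurable fun ω => (A ω - K) i j := fun i j => (mA i j).sub_const _
  have mhD := hs_meas mD
  set S : Ω → Matrix (Fin d) (Fin d) ℝ := fun ω => R * (A ω - K) * Rᵀ with hSdef
  have mS : ∀ i j, Measurable fun ω => S ω i j := fun i j => by
    simp only [hSdef, Matrix.mul_apply]
    exact Finset.measurable_sum _ fun k _ => (Finset.measurable_sum _ fun l _ =>
      (mD l k).const_mul _).mul_const _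
  have symD : ∀ ω, (A ω - K)ᵀ = A ω - K := fun ω => by
    rw [transpose_sub, pd_symm (hpsd ω), pd_symm hK.posSemidef]
  have symS : ∀ ω, (S ω)ᵀ = S ω := fun ω => by
    simp only [hSdef]
    rw [transpose_mul, transpose_mul, transpose_transpose, symD, Matrix.mul_assoc]
  set e : Ω → ℝ := fun ω => hsNorm (A ω - K) / lambdaMin K with hedef
  have me : Measurable e := mhD.div_const _
  have hSe : ∀ ω, hsNorm (S ω) ≤ e ω := fun ω => by
    refine (hs_whiten hR (symD ω)).trans ?_
    rw [hedef, le_div_iff₀ hl]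
    apply le_of_sq_le_sq _ (hs_nonneg _)
    rw [mul_pow, mul_comm]
    exact hs_inv hd hK _
  have iD8 : Integrable (fun ω => hsNorm (A ω - K) ^ 8) P := by
    refine ((hA8.add (integrable_const (hsNorm K ^ 8))).const_mul 128).mono'
      (mhD.pow_const 8).aestronglyMeasurable (ae_of_all _ fun ω => ?_)
    rw [Real.norm_eq_abs, abs_of_nonneg (by positivity)]
    refine (pow_le_pow_left₀ (hs_nonneg _) (hs_sub _ _) 8).trans ?_
    have := add_pow_le (hs_nonneg (A ω)) (hs_nonneg K) 8
    norm_num at this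
    simpa using this
  have iD4 : Integrable (fun ω => hsNorm (A ω - K) ^ 4) P :=
    pow_int P _ _ (fun ω => hs_nonneg _) iD8 (mhD.pow_const 4) 4 (by norm_num) fun ω => by
      rw [abs_of_nonneg]; have := hs_nonneg (A ω - K); positivity
  have iD : ∀ i j, Integrable (fun ω => (A ω - K) i j) P := fun i j =>
    pow_int P _ _ (fun ω => hs_nonneg _) iD8 (mD i j) 1 (by norm_num) fun ω => by
      rw [pow_one]; exact entry_le _ _ _
  have iV : Integrable (fun ω => e ω ^ 4) P := by
    simp only [hedef, div_pow]
    exact iD4.div_const _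
  set E1 : Set Ω := {ω | e ω ≤ 1/2} with hE1
  have mE1 : MeasurableSet E1 := measurableSet_le me measurable_const
  have mE := ev_meas hd K hAm
  set E2 : Set Ω := EvSet A K \ E1 with hE2
  have mE2 : MeasurableSet E2 := mE.diff mE1
  have sub : E1 ⊆ EvSet A K := fun ω hω => by
    have h1 : hsNorm (A ω - K) / lambdaMin K ≤ 1/2 := hω
    rw [div_le_iff₀ hl] at h1
    have h2 := op_le_hs hd (A ω - K)
    show opNorm (A ω - K) ≤ lambdaMin K / 2
    linarith
  obtain ⟨m1, m2, m3⟩ := moment P S e mS symS me hSe iV E1 E2 hE1 mE2 (fun ω h => h.2)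
  have un : E1 ∪ E2 = EvSet A K := Set.union_sdiff_cancel sub
  have dj : Disjoint E1 E2 := Set.disjoint_sdiff_right
  have good : ∀ ω ∈ EvSet A K, (∀ x, 0 < gaussDensity (A ω) x) ∧ Integrable (gaussDensity (A ω)) ∧
      ∫ x, gaussDensity (A ω) x = 1 := fun ω hω =>
    ⟨gd_pos (A_pd hd hK (hpsd ω) hω), gd_int (A_pd hd hK (hpsd ω) hω)⟩
  have mf : Measurable fun p : Ω × (Fin d → ℝ) => gaussDensity (A p.1) p.2 :=
    gd_meas (M := fun p : Ω × (Fin d → ℝ) => A p.1) (fun i j => (mA i j).comp measurable_fst) measurable_snd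
  have mφ : Measurable (gaussDensity K) :=
    gd_meas (M := fun _ : Fin d → ℝ => K) (fun i j => measurable_const) measurable_id
  have hg : ∀ᵐ x : Fin d → ℝ, (∫ ω in EvSet A K, gaussDensity (A ω) x ∂P) =
      (∫ ω in E1, gaussDensity (A ω) x ∂P) + ∫ ω in E2, gaussDensity (A ω) x ∂P := by
    have i0 : Integrable (fun p : Ω × (Fin d → ℝ) => gaussDensity (A p.1) p.2)
        ((P.restrict (EvSet A K)).prod volume) := by
      rw [integrable_prod_iff mf.aestronglyMeasurable]
      refine ⟨(ae_restrict_mem mE).mono fun ω hω => (good ω hω).2.1, ?_⟩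
      refine (integrable_const (1:ℝ)).congr ((ae_restrict_mem mE).mono fun ω hω => ?_)
      obtain ⟨g1, -, g3⟩ := good ω hω
      simp only [Real.norm_eq_abs, abs_of_pos (g1 _)]
      exact g3.symm
    filter_upwards [i0.prod_left_ae] with x hx
    rw [← un] at hx ⊢
    exact setIntegral_union dj mE2 (IntegrableOn.left_of_union hx) (IntegrableOn.right_of_union hx)
  have hp : (P (EvSet A K)).toReal = (P.restrict E1).real Set.univ + (P.restrict E2).real Set.univ := by
    rw [measureReal_restrict_apply_univ, measureReal_restrict_apply_univ, ← measureReal_union dj mE2, un]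
    rfl
  have main := entropy_abs volume (P.restrict E1) (P.restrict E2) (fun ω => gaussDensity (A ω))
    (gaussDensity K) (fun ω => hsNorm (S ω) ^ 2) _ mf mφ (gd_pos hK) ((hs_meas mS).pow_const 2) m2 m1
    ((ae_restrict_mem mE1).mono fun ω hω => good ω (sub hω))
    ((ae_restrict_mem mE2).mono fun ω hω => good ω hω.1)
    ((ae_restrict_mem mE2).mono fun ω hω => ⟨(I_int hd hK hR (hpsd ω) hω.1 (hpsd ω) hω.1).2.1,
      I_bound_large hd hK hR (hpsd ω) hω.1⟩)
    (by
      rw [Measure.prod_restrict]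
      refine (ae_restrict_mem (mE1.prod mE1)).mono fun p hp => ?_
      obtain ⟨a1, a2, a3⟩ := I_int hd hK hR (hpsd p.1) (sub hp.1) (hpsd p.2) (sub hp.2)
      refine ⟨a2, a3.le.trans (inv_sqrt_bound ?_ a1)⟩
      have b1 : e p.1 ≤ 1/2 := hp.1
      have b2 : e p.2 ≤ 1/2 := hp.2
      have := mul_le_mul ((hSe p.1).trans b1) ((hSe p.2).trans b2) (hs_nonneg _) (by norm_num)
      norm_num at this ⊢
      exact this)
    _ hg _ hp hF
  refine main.trans (m3.trans (add_le_add ?_ ?_))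
  · have eS : (Matrix.of fun i j => ∫ ω, S ω i j ∂P)
        = R * ((Matrix.of fun i j => ∫ ω, A ω i j ∂P) - K) * Rᵀ := by
      ext i j
      have iA : ∀ i j, ∫ ω, (A ω - K) i j ∂P = (∫ ω, A ω i j ∂P) - K i j := fun i j => by
        have : Integrable (fun ω => A ω i j) P := by
          have := (iD i j).add (integrable_const (K i j))
          refine this.congr (ae_of_all _ fun ω => by simp)
        simp only [Matrix.sub_apply]
        rw [integral_sub this (integrable_const _)]
        simp
      simp only [hSdef, Matrix.mul_apply, Matrix.of_apply]
      rw [integral_finsetSum _ fun k _ => (integrable_finsetSum _ fun l _ => (iD l k).const_mul _).mul_const _]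
      refine Finset.sum_congr rfl fun k _ => ?_
      rw [integral_mul_const, integral_finsetSum _ fun l _ => (iD l k).const_mul _]
      congr 1
      refine Finset.sum_congr rfl fun l _ => ?_
      rw [integral_const_mul, iA]
      simp [Matrix.sub_apply]
    have symB : ((Matrix.of fun i j => ∫ ω, A ω i j ∂P) - K)ᵀ = (Matrix.of fun i j => ∫ ω, A ω i j ∂P) - K := by
      rw [transpose_sub, pd_symm hK.posSemidef]
      congr 1
      ext i j
      simp only [transpose_apply, Matrix.of_apply]
      exact integral_congr_ae (ae_of_all _ fun ω => congrFun (congrFun (pd_symm (hpsd ω)) i) j)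
    rw [eS, ← mul_pow]
    have h1 := (hs_whiten hR symB).trans (hs_mul _ _)
    rw [mul_comm] at h1
    have := pow_le_pow_left₀ (hs_nonneg _) h1 2
    linarith
  · refine mul_le_mul_of_nonneg_left ?_ (by norm_num)
    simp only [hedef, div_pow]
    rw [integral_div]
    refine div_le_div_of_nonneg_right ?_ (by positivity)
    apply Real.le_sqrt_of_sq_le
    have := cs_int P _ iD4 (by simpa only [← pow_mul] using iD8)
    simpa [← pow_mul] using this

/-- Lemma `inE`: entropy-type bound on the event `E`. -/
theorem statement_5
    {d : ℕ} (hd : 1 ≤ d)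
    {Ω : Type*} [mΩ : MeasurableSpace Ω] (P : Measure Ω) [IsProbabilityMeasure P]
    (K : Matrix (Fin d) (Fin d) ℝ) (hK : K.PosDef)
    (G F : Ω → Fin d → ℝ) (hG : Measure.map G P = gaussLaw K)
    (𝓕 : {m : MeasurableSpace Ω // m ≤ mΩ})
    (A : Ω → Matrix (Fin d) (Fin d) ℝ)
    (hFA : CondGaussian P F 𝓕.1 A)
    (hA8 : Integrable (fun ω => hsNorm (A ω) ^ 8) P)
    (hPE : P (EvSet A K) ≠ 0) :
    (∫ x : Fin d → ℝ,
        (∫ ω in EvSet A K, gaussDensity (A ω) x ∂P) *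
          Real.log ((∫ ω in EvSet A K, gaussDensity (A ω) x ∂P) /
            ((P (EvSet A K)).toReal * gaussDensity K x))) ≤
      (Real.sqrt 3 / (12 * Real.sqrt 2)) * Cfac d * hsNorm K⁻¹ ^ 2 *
        hsNorm ((Matrix.of fun i j => ∫ ω, A ω i j ∂P) - K) ^ 2
      + ( (Real.sqrt 2 / (lambdaMin K ^ 4 * Real.sqrt 3)) * Cfac d * hsNorm K⁻¹ ^ 2 *
            (lambdaMin K ^ 2 + 4 * hsNorm K ^ 2)
        + (Real.sqrt 70 * (d : ℝ) ^ 2 / lambdaMin K ^ 4) *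
            ((1/2) * maxLog K + (Real.sqrt 2 + 1) * (d : ℝ) / 4)
        + (3 + Real.sqrt 3 / 8 + 5 * Real.sqrt 10 + 4 * Real.sqrt 30 / 3
            + Real.sqrt 15 / 3 + 10 * Real.sqrt 5 / 3) * (d : ℝ) ^ 2 / lambdaMin K ^ 4 ) *
        Real.sqrt (∫ ω, hsNorm (A ω - K) ^ 8 ∂P) := by
  obtain ⟨-, -, hpsd, hAm, -⟩ := hFA
  have hl := lam_pos hd hK
  refine (final hd P K hK A hpsd (hAm.mono 𝓕.2 le_rfl) hA8).trans (add_le_add ?_ ?_)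
  · rw [mul_assoc (_ * Cfac d)]
    exact mul_le_mul_of_nonneg_right (const1 hd) (by positivity)
  · rw [← mul_div_assoc, mul_comm 30, mul_div_assoc, mul_comm]
    refine mul_le_mul_of_nonneg_right ?_ (Real.sqrt_nonneg _)
    have hC : 0 ≤ Cfac d := by unfold Cfac; positivity
    have hm : 0 ≤ maxLog K := (abs_nonneg _).trans (le_max_left _ _)
    have t1 : 0 ≤ (Real.sqrt 2 / (lambdaMin K ^ 4 * Real.sqrt 3)) * Cfac d * hsNorm K⁻¹ ^ 2 *
            (lambdaMin K ^ 2 + 4 * hsNorm K ^ 2) := by positivity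
    have t2 : 0 ≤ (Real.sqrt 70 * (d : ℝ) ^ 2 / lambdaMin K ^ 4) *
            ((1/2) * maxLog K + (Real.sqrt 2 + 1) * (d : ℝ) / 4) := by positivity
    have t3 := div_le_div_of_nonneg_right (const2 hd) (show 0 ≤ lambdaMin K ^ 4 by positivity)
    linarith
end

section
/- On the event E := {‖A−K‖_op ≤ λ(K)/2}, for every integer k ≥ 1, every t ∈ [0,1] and every x ∈ ℝ^d, (∂^k g/∂t^k)(A,t,x) = 2^{−k}·⟨ (A−K)^{⊗k} , ∇^{2k}φ_{Γ_t}(x)/φ_{Γ_t}(x) ⟩ · g(A,t,x), where (A−K)^{⊗k} ∈ ℝ^{(d×d)^k} has entries (A−K)_{i₁,i₂}⋯(A−K)_{i_{2k−1},i_{2k}}, ∇^{2k}φ_{Γ_t}(x) is the tensor of all mixed partial derivatives of order 2k of φ_{Γ_t} in x, and ⟨·,·⟩ is the scalar product on ℝ^{(d×d)^k}. -/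
open MeasureTheory ProbabilityTheory Matrix

noncomputable section

/-- The interpolating matrix `Γ_t = tA + (1−t)K`. -/
def Gam {d : ℕ} (A K : Matrix (Fin d) (Fin d) ℝ) (t : ℝ) : Matrix (Fin d) (Fin d) ℝ :=
  t • A + (1 - t) • K

/-- The interpolating density ratio `g(A,t,x) = φ_{Γ_t}(x)/φ_K(x)`. -/
def gfun {d : ℕ} (A K : Matrix (Fin d) (Fin d) ℝ) (t : ℝ) (x : Fin d → ℝ) : ℝ :=
  gaussDensity (Gam A K t) x / gaussDensity K x

/-- `h_k(A,t,x) = (∂^k g/∂t^k)(A,t,x) / g(A,t,x)`. -/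
def hfun {d : ℕ} (k : ℕ) (A K : Matrix (Fin d) (Fin d) ℝ) (t : ℝ) (x : Fin d → ℝ) : ℝ :=
  iteratedDeriv k (fun s => gfun A K s x) t / gfun A K t x

/-- `g̃(A,t,x) = E[φ_{Γ_t}(x) 1_E] / (P(E) φ_K(x))`. -/
def gtilde {Ω : Type*} [MeasurableSpace Ω] (P : Measure Ω) {d : ℕ}
    (A : Ω → Matrix (Fin d) (Fin d) ℝ) (K : Matrix (Fin d) (Fin d) ℝ)
    (t : ℝ) (x : Fin d → ℝ) : ℝ :=
  (∫ ω in EvSet A K, gaussDensity (Gam (A ω) K t) x ∂P) /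
    ((P (EvSet A K)).toReal * gaussDensity K x)

end

/-- Iterated mixed partial derivative of `φ : ℝ^d → ℝ` along a list of coordinates. -/
noncomputable def mixedPartial {d : ℕ} (φ : (Fin d → ℝ) → ℝ) :
    List (Fin d) → (Fin d → ℝ) → ℝ
  | [], x => φ x
  | i :: is, x => fderiv ℝ (mixedPartial φ is) x (Pi.single i 1)


namespace St8

open scoped ContDiff

/-- Directional derivative. -/
noncomputable def Dv {E : Type*} [NormedAddCommGroup E] [NormedSpace ℝ E] (v : E) (f : E → ℝ) :
    E → ℝ := fun p => fderiv ℝ f p v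

section abstr

variable {E : Type*} [NormedAddCommGroup E] [NormedSpace ℝ E] {V : Set E}

lemma Dv_congr (hV : IsOpen V) {f g : E → ℝ} (h : Set.EqOn f g V) (v : E) :
    Set.EqOn (Dv v f) (Dv v g) V := by
  intro p hp
  have : f =ᶠ[nhds p] g := Filter.eventuallyEq_of_mem (hV.mem_nhds hp) h
  simp only [Dv, this.fderiv_eq]

lemma Dv_smooth (hV : IsOpen V) {f : E → ℝ} (h : ContDiffOn ℝ ∞ f V) (v : E) :
    ContDiffOn ℝ ∞ (Dv v f) V := by
  have := h.fderiv_of_isOpen (m := ∞) hV (by simp)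
  exact this.clm_apply contDiffOn_const

lemma diffAt (hV : IsOpen V) {f : E → ℝ} (h : ContDiffOn ℝ ∞ f V) {p : E} (hp : p ∈ V) :
    DifferentiableAt ℝ f p :=
  (h.contDiffAt (hV.mem_nhds hp)).differentiableAt (by simp)

lemma Dv_comm (hV : IsOpen V) {f : E → ℝ} (h : ContDiffOn ℝ ∞ f V) (v w : E) :
    Set.EqOn (Dv v (Dv w f)) (Dv w (Dv v f)) V := by
  intro p hp
  have hf := h.contDiffAt (hV.mem_nhds hp)
  have hs := hf.isSymmSndFDerivAt (by simpa using (WithTop.coe_le_coe.2 (le_top : (2 : ℕ∞) ≤ ⊤))) v w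
  have hd : DifferentiableAt ℝ (fderiv ℝ f) p :=
    ((h.fderiv_of_isOpen (m := ∞) hV (by simp)).contDiffAt (hV.mem_nhds hp)).differentiableAt
      (by simp)
  have key : ∀ a b : E, Dv a (Dv b f) p = fderiv ℝ (fderiv ℝ f) p a b := by
    intro a b
    change fderiv ℝ (fun y => fderiv ℝ f y b) p a = _
    rw [fderiv_clm_apply hd (differentiableAt_const b)]
    simp
  rw [key, key, hs]

lemma Dv_sum (hV : IsOpen V) {ι : Type*} (s : Finset ι) (c : ι → ℝ) (f : ι → E → ℝ)
    (h : ∀ a, ContDiffOn ℝ ∞ (f a) V) (v : E) :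
    Set.EqOn (Dv v (fun p => ∑ a ∈ s, c a * f a p)) (fun p => ∑ a ∈ s, c a * Dv v (f a) p) V := by
  intro p hp
  simp only [Dv]
  rw [fderiv_fun_sum (fun a _ => (diffAt hV (h a) hp).const_mul (c a))]
  simp only [_root_.sum_apply]
  refine Finset.sum_congr rfl fun a _ => ?_
  rw [fderiv_const_mul (diffAt hV (h a) hp)]
  simp

lemma Dv_smul (hV : IsOpen V) {f : E → ℝ} (c : ℝ)
    (h : ContDiffOn ℝ ∞ f V) (v : E) :
    Set.EqOn (Dv v (fun p => c * f p)) (fun p => c * Dv v f p) V := by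
  have := Dv_sum hV (Finset.univ : Finset Unit) (fun _ => c) (fun _ => f) (fun _ => h) v
  simpa using this

lemma sum_smooth {ι : Type*} (s : Finset ι) (c : ι → ℝ) (f : ι → E → ℝ)
    (h : ∀ a, ContDiffOn ℝ ∞ (f a) V) :
    ContDiffOn ℝ ∞ (fun p => ∑ a ∈ s, c a * f a p) V :=
  ContDiffOn.sum fun a _ => contDiffOn_const.mul (h a)

lemma Dv_eq {f : E → ℝ} {p v : E} {f' : ℝ} (h : DifferentiableAt ℝ f p)
    (hder : HasDerivAt (fun r : ℝ => f (p + r • v)) f' 0) : Dv v f p = f' := by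
  have h1 : HasDerivAt (fun r : ℝ => f (p + r • v)) (fderiv ℝ f p v) 0 :=
    h.hasFDerivAt.hasLineDerivAt v
  exact h1.unique hder

/-- second order operator -/
noncomputable def Lp {ι : Type*} [Fintype ι] (B : Matrix ι ι ℝ) (e : ι → E) (f : E → ℝ) : E → ℝ :=
  fun p => ∑ q : ι × ι, B q.1 q.2 * Dv (e q.1) (Dv (e q.2) f) p

variable {ι : Type*} [Fintype ι] (B : Matrix ι ι ℝ) (e : ι → E)

lemma Lp_congr (hV : IsOpen V) {f g : E → ℝ} (h : Set.EqOn f g V) :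
    Set.EqOn (Lp B e f) (Lp B e g) V := by
  intro p hp
  simp only [Lp]
  refine Finset.sum_congr rfl fun q _ => ?_
  rw [Dv_congr hV (Dv_congr hV h _) _ hp]

lemma Lp_smooth (hV : IsOpen V) {f : E → ℝ} (h : ContDiffOn ℝ ∞ f V) :
    ContDiffOn ℝ ∞ (Lp B e f) V :=
  sum_smooth _ _ _ fun q => Dv_smooth hV (Dv_smooth hV h _) _

lemma Lp_smul (hV : IsOpen V) {f : E → ℝ} (c : ℝ) (h : ContDiffOn ℝ ∞ f V) :
    Set.EqOn (Lp B e (fun p => c * f p)) (fun p => c * Lp B e f p) V := by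
  intro p hp
  simp only [Lp, Finset.mul_sum]
  refine Finset.sum_congr rfl fun q _ => ?_
  rw [Dv_congr hV (Dv_smul hV c h _) _ hp, Dv_smul hV c (Dv_smooth hV h _) _ hp]
  ring

lemma Dv_Lp (hV : IsOpen V) {f : E → ℝ} (h : ContDiffOn ℝ ∞ f V) (v : E) :
    Set.EqOn (Dv v (Lp B e f)) (Lp B e (Dv v f)) V := by
  intro p hp
  have := Dv_sum hV (Finset.univ : Finset (ι × ι)) (fun q => B q.1 q.2)
    (fun q => Dv (e q.1) (Dv (e q.2) f))
    (fun q => Dv_smooth hV (Dv_smooth hV h _) _) v hp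
  refine this.trans ?_
  simp only [Lp]
  refine Finset.sum_congr rfl fun q _ => ?_
  rw [Dv_comm hV (Dv_smooth hV h _) _ _ hp, Dv_congr hV (Dv_comm hV h _ _) _ hp]

lemma iter_smooth (hV : IsOpen V) {f : E → ℝ} (h : ContDiffOn ℝ ∞ f V) (k : ℕ) :
    ContDiffOn ℝ ∞ ((Lp B e)^[k] f) V := by
  induction k with
  | zero => simpa using h
  | succ k ih => rw [Function.iterate_succ_apply']; exact Lp_smooth B e hV ih

lemma Dv_iter_smooth (hV : IsOpen V) {f : E → ℝ} (h : ContDiffOn ℝ ∞ f V) (v : E) (k : ℕ) :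
    ContDiffOn ℝ ∞ ((Dv v)^[k] f) V := by
  induction k with
  | zero => simpa using h
  | succ k ih => rw [Function.iterate_succ_apply']; exact Dv_smooth hV ih _

lemma Dv_Lp_iter (hV : IsOpen V) {f : E → ℝ} (h : ContDiffOn ℝ ∞ f V) (v : E) {c : ℝ}
    (heat : Set.EqOn (Dv v f) (fun p => c * Lp B e f p) V) (k : ℕ) :
    Set.EqOn (Dv v ((Lp B e)^[k] f)) (fun p => c * (Lp B e)^[k+1] f p) V := by
  induction k with
  | zero => simpa using heat
  | succ k ih =>
    intro p hp
    rw [Function.iterate_succ_apply']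
    rw [Dv_Lp B e hV (iter_smooth B e hV h k) v hp, Lp_congr B e hV ih hp,
      Lp_smul B e hV c (iter_smooth B e hV h (k+1)) hp, ← Function.iterate_succ_apply' (Lp B e)]

lemma main_iter (hV : IsOpen V) {f : E → ℝ} (h : ContDiffOn ℝ ∞ f V) (v : E) {c : ℝ}
    (heat : Set.EqOn (Dv v f) (fun p => c * Lp B e f p) V) (k : ℕ) :
    Set.EqOn ((Dv v)^[k] f) (fun p => c ^ k * (Lp B e)^[k] f p) V := by
  induction k with
  | zero => intro p _; simp
  | succ k ih =>
    intro p hp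
    rw [Function.iterate_succ_apply', Dv_congr hV ih _ hp,
      Dv_smul hV _ (iter_smooth B e hV h k) _ hp]
    simp only []
    rw [Dv_Lp_iter B e hV h v heat k hp]
    ring

/-- iterated directional derivative along a list -/
noncomputable def Dl (f : E → ℝ) : List ι → E → ℝ
  | [] => f
  | i :: is => Dv (e i) (Dl f is)

lemma Dl_smooth (hV : IsOpen V) {f : E → ℝ} (h : ContDiffOn ℝ ∞ f V) (l : List ι) :
    ContDiffOn ℝ ∞ (Dl e f l) V := by
  induction l with
  | nil => exact h
  | cons i l ih => exact Dv_smooth hV ih _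

end abstr

section sums
variable {E : Type*} [NormedAddCommGroup E] [NormedSpace ℝ E] {V : Set E}
variable {d : ℕ} (B : Matrix (Fin d) (Fin d) ℝ) (e : Fin d → E)

/-- reindexing -/
def eqv (d k : ℕ) : (Fin d × Fin d) × (Fin (2 * k) → Fin d) ≃ (Fin (2 * (k + 1)) → Fin d) where
  toFun q := (Fin.cons q.1.1 (Fin.cons q.1.2 q.2 : Fin (2 * k + 1) → Fin d) :
    Fin (2 * k + 1 + 1) → Fin d)
  invFun ι := ((ι ⟨0, by omega⟩, ι ⟨1, by omega⟩), fun m => ι ⟨m.1 + 2, by omega⟩)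
  left_inv q := rfl
  right_inv ι := by
    funext m
    obtain ⟨m, hm⟩ := m
    match m, hm with
    | 0, _ => rfl
    | 1, _ => rfl
    | m + 2, _ => rfl

/-- coefficient -/
def coef (k : ℕ) (ι : Fin (2 * k) → Fin d) : ℝ :=
  ∏ m : Fin k,
    B (ι ⟨2 * m.1, by have := m.2; omega⟩) (ι ⟨2 * m.1 + 1, by have := m.2; omega⟩)

lemma coef_succ (k : ℕ) (q : (Fin d × Fin d) × (Fin (2 * k) → Fin d)) :
    coef B (k + 1) (eqv d k q) = B q.1.1 q.1.2 * coef B k q.2 := by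
  unfold coef
  rw [Fin.prod_univ_succ]
  rfl

lemma ofFn_succ (k : ℕ) (q : (Fin d × Fin d) × (Fin (2 * k) → Fin d)) :
    List.ofFn (eqv d k q) = q.1.1 :: q.1.2 :: List.ofFn q.2 := by
  have : List.ofFn (eqv d k q) = List.ofFn (Fin.cons q.1.1 (Fin.cons q.1.2 q.2 : Fin (2 * k + 1) → Fin d) :
    Fin (2 * k + 1 + 1) → Fin d) := rfl
  rw [this, List.ofFn_succ, List.ofFn_succ]
  rfl

lemma sum_eq_iter (hV : IsOpen V) {f : E → ℝ} (h : ContDiffOn ℝ ∞ f V) (k : ℕ) :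
    Set.EqOn (fun p => ∑ ι : Fin (2 * k) → Fin d, coef B k ι * Dl e f (List.ofFn ι) p)
      ((Lp B e)^[k] f) V := by
  induction k with
  | zero =>
    intro p _
    have : ∀ ι : Fin (2 * 0) → Fin d, coef B 0 ι * Dl e f (List.ofFn ι) p = f p := by
      intro ι
      have : List.ofFn ι = [] := List.ofFn_zero
      rw [this]; simp [coef, Dl]
    simp only [this]
    have h1 : Fintype.card (Fin (2 * 0) → Fin d) = 1 := by simp
    rw [Finset.sum_const, Finset.card_univ, h1]; simp
  | succ k ih =>
    intro p hp
    rw [Function.iterate_succ_apply', ← Lp_congr B e hV ih hp]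
    simp only [Lp]
    rw [← (eqv d k).sum_comp, Fintype.sum_prod_type]
    refine Finset.sum_congr rfl fun q _ => ?_
    have hs : ∀ ι : Fin (2 * k) → Fin d, ContDiffOn ℝ ∞ (Dl e f (List.ofFn ι)) V :=
      fun ι => Dl_smooth e hV h _
    rw [Dv_congr hV (Dv_sum hV _ _ _ hs _) _ hp,
      Dv_sum hV _ _ _ (fun ι => Dv_smooth hV (hs ι) _) _ hp, Finset.mul_sum]
    refine Finset.sum_congr rfl fun ι _ => ?_
    rw [coef_succ, ofFn_succ]
    simp only [Dl]
    ring
end sums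

section prod
variable {d : ℕ} {U : Set ℝ}

/-- spatial basis vectors -/
def ee (d : ℕ) (i : Fin d) : ℝ × (Fin d → ℝ) := (0, Pi.single i 1)

lemma V_open (hU : IsOpen U) : IsOpen (U ×ˢ (Set.univ : Set (Fin d → ℝ))) := hU.prod isOpen_univ

lemma mixed_eq (hU : IsOpen U) {G : ℝ × (Fin d → ℝ) → ℝ}
    (h : ContDiffOn ℝ ∞ G (U ×ˢ Set.univ)) {s : ℝ} (hs : s ∈ U) (l : List (Fin d)) :
    mixedPartial (fun y => G (s, y)) l = fun x => Dl (ee d) G l (s, x) := by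
  induction l with
  | nil => rfl
  | cons i l ih =>
    funext x
    simp only [mixedPartial, Dl, Dv]
    rw [ih]
    have hd := diffAt (V_open hU) (Dl_smooth (ee d) (V_open hU) h l) (p := (s, x)) ⟨hs, trivial⟩
    have h2 : HasFDerivAt (fun y : Fin d → ℝ => (s, y)) (ContinuousLinearMap.inr ℝ ℝ (Fin d → ℝ)) x :=
      hasFDerivAt_prodMk_right s x
    have := hd.hasFDerivAt.comp x h2
    have h3 := this.fderiv
    simp only [Function.comp_def] at h3
    rw [h3]
    rfl

lemma iter_eq (hU : IsOpen U) {G : ℝ × (Fin d → ℝ) → ℝ}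
    (h : ContDiffOn ℝ ∞ G (U ×ˢ Set.univ)) (x : Fin d → ℝ) (k : ℕ) {s : ℝ} (hs : s ∈ U) :
    iteratedDeriv k (fun r => G (r, x)) s = (Dv ((1, 0) : ℝ × (Fin d → ℝ)))^[k] G (s, x) := by
  induction k generalizing s with
  | zero => simp
  | succ k ih =>
    rw [iteratedDeriv_succ, Function.iterate_succ_apply']
    have : iteratedDeriv k (fun r => G (r, x)) =ᶠ[nhds s]
        fun r => (Dv ((1, 0) : ℝ × (Fin d → ℝ)))^[k] G (r, x) :=
      Filter.eventuallyEq_of_mem (hU.mem_nhds hs) fun r hr => ih hr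
    rw [this.deriv_eq]
    have hd := diffAt (V_open hU) (Dv_iter_smooth (V_open hU) h (1, 0) k) (p := (s, x)) ⟨hs, trivial⟩
    have h2 : HasFDerivAt (fun r : ℝ => (r, x)) (ContinuousLinearMap.inl ℝ ℝ (Fin d → ℝ)) s :=
      hasFDerivAt_prodMk_left s x
    have := (hd.hasFDerivAt.comp s h2).hasDerivAt.deriv
    simp only [Function.comp_def] at this
    rw [this]
    simp [Dv]

lemma abstract_main (hU : IsOpen U) {G : ℝ × (Fin d → ℝ) → ℝ} (B : Matrix (Fin d) (Fin d) ℝ)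
    (h : ContDiffOn ℝ ∞ G (U ×ˢ Set.univ))
    (heat : Set.EqOn (Dv (1, 0) G) (fun p => (1/2) * Lp B (ee d) G p) (U ×ˢ Set.univ))
    (k : ℕ) {s : ℝ} (hs : s ∈ U) (x : Fin d → ℝ) :
    iteratedDeriv k (fun r => G (r, x)) s =
      (1/2) ^ k * ∑ ι : Fin (2 * k) → Fin d, coef B k ι *
        mixedPartial (fun y => G (s, y)) (List.ofFn ι) x := by
  have hp : (s, x) ∈ U ×ˢ (Set.univ : Set (Fin d → ℝ)) := ⟨hs, trivial⟩
  rw [iter_eq hU h x k hs, main_iter B (ee d) (V_open hU) h _ heat k hp]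
  simp only []
  rw [← sum_eq_iter B (ee d) (V_open hU) h k hp]
  simp only [mixed_eq hU h hs]

end prod

section heat
variable {d : ℕ}

lemma det_smooth {E : Type*} [NormedAddCommGroup E] [NormedSpace ℝ E]
    {M : E → Matrix (Fin d) (Fin d) ℝ} (h : ∀ i j, ContDiff ℝ ∞ fun p => M p i j) :
    ContDiff ℝ ∞ fun p => (M p).det := by
  simp only [Matrix.det_apply]
  refine ContDiff.sum fun σ _ => ?_
  refine ContDiff.const_smul _ ?_
  exact contDiff_prod fun i _ => h _ _

lemma inv_smooth {E : Type*} [NormedAddCommGroup E] [NormedSpace ℝ E]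
    {M : E → Matrix (Fin d) (Fin d) ℝ} (h : ∀ i j, ContDiff ℝ ∞ fun p => M p i j) {V : Set E}
    (hV : ∀ p ∈ V, (M p).det ≠ 0) (i j : Fin d) :
    ContDiffOn ℝ ∞ (fun p => (M p)⁻¹ i j) V := by
  have : (fun p => (M p)⁻¹ i j) =
      fun p => (M p).det⁻¹ * ((M p).updateRow j (Pi.single i 1)).det := by
    funext p
    rw [Matrix.inv_def, Matrix.smul_apply, Matrix.adjugate_apply, Ring.inverse_eq_inv', smul_eq_mul]
  rw [this]
  refine ((det_smooth h).contDiffOn.inv hV).mul (ContDiff.contDiffOn (det_smooth fun a b => ?_))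
  by_cases hab : a = j
  · subst hab
    simp only [Matrix.updateRow_self]
    exact contDiff_const
  · simp only [Matrix.updateRow_ne hab]
    exact h a b

lemma Gam_eq (A K : Matrix (Fin d) (Fin d) ℝ) (s r : ℝ) :
    Gam A K (s + r) = Gam A K s + r • (A - K) := by
  ext i j
  simp [Gam]; ring

/-- the joint function -/
noncomputable def GG (A K : Matrix (Fin d) (Fin d) ℝ) (p : ℝ × (Fin d → ℝ)) : ℝ :=
  gaussDensity (Gam A K p.1) p.2

/-- good times -/
def UU (A K : Matrix (Fin d) (Fin d) ℝ) : Set ℝ := {s | 0 < (Gam A K s).det}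

lemma Gam_smooth (A K : Matrix (Fin d) (Fin d) ℝ) (i j : Fin d) :
    ContDiff ℝ ∞ fun s : ℝ => Gam A K s i j := by
  simp only [Gam, Matrix.add_apply, Matrix.smul_apply, smul_eq_mul]
  fun_prop

lemma UU_open (A K : Matrix (Fin d) (Fin d) ℝ) : IsOpen (UU A K) :=
  isOpen_lt continuous_const (det_smooth (Gam_smooth A K)).continuous

lemma GG_smooth (A K : Matrix (Fin d) (Fin d) ℝ) :
    ContDiffOn ℝ ∞ (GG A K) (UU A K ×ˢ Set.univ) := by
  have hG : ∀ i j, ContDiff ℝ ∞ fun p : ℝ × (Fin d → ℝ) => Gam A K p.1 i j :=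
    fun i j => (Gam_smooth A K i j).comp contDiff_fst
  have hpos : ∀ p ∈ UU A K ×ˢ (Set.univ : Set (Fin d → ℝ)),
      0 < (2 * Real.pi) ^ d * (Gam A K p.1).det := fun p hp =>
    mul_pos (by positivity) hp.1
  unfold GG gaussDensity
  refine ContDiffOn.mul (ContDiffOn.inv (ContDiffOn.sqrt
    (contDiffOn_const.mul (det_smooth hG).contDiffOn) fun p hp => (hpos p hp).ne')
    fun p hp => (Real.sqrt_pos.2 (hpos p hp)).ne') (ContDiffOn.exp (contDiffOn_const.mul ?_))
  simp only [dotProduct, Matrix.mulVec]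
  have hx : ∀ i : Fin d, ContDiffOn ℝ ∞ (fun p : ℝ × (Fin d → ℝ) => p.2 i)
      (UU A K ×ˢ (Set.univ : Set (Fin d → ℝ))) := fun i => by
    apply ContDiff.contDiffOn; fun_prop
  refine ContDiffOn.sum fun i _ => (hx i).mul (ContDiffOn.sum fun j _ => ?_)
  exact (inv_smooth hG (fun p hp => ne_of_gt hp.1) i j).mul (hx j)

lemma det_deriv (M B : Matrix (Fin d) (Fin d) ℝ) (hM : M.det ≠ 0) :
    HasDerivAt (fun r : ℝ => (M + r • B).det) (M.det * (M⁻¹ * B).trace) 0 := by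
  have hu : IsUnit M.det := isUnit_iff_ne_zero.2 hM
  have h1 : ∀ r : ℝ, (M + r • B).det = M.det * (1 + (M⁻¹ * B).trace * r +
      ((1 + (Polynomial.X : Polynomial ℝ) • (M⁻¹ * B).map Polynomial.C).det).divX.divX.eval r
        * r ^ 2) := by
    intro r
    rw [← Matrix.det_one_add_smul, ← Matrix.det_mul]
    congr 1
    rw [Matrix.mul_add, Matrix.mul_smul, Matrix.mul_one, Matrix.mul_nonsing_inv_cancel_left _ _ hu]
  simp only [h1]
  generalize ((1 + (Polynomial.X : Polynomial ℝ) • (M⁻¹ * B).map Polynomial.C).det).divX.divX = P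
  have := ((((hasDerivAt_id (0:ℝ)).const_mul (M⁻¹ * B).trace).const_add 1).add
    ((P.hasDerivAt 0).mul ((hasDerivAt_id (0:ℝ)).pow 2))).const_mul M.det
  refine this.congr_deriv ?_
  simp

lemma quad_deriv (M B : Matrix (Fin d) (Fin d) ℝ) (hM : M.det ≠ 0) (x : Fin d → ℝ) :
    HasDerivAt (fun r : ℝ => x ⬝ᵥ (M + r • B)⁻¹ *ᵥ x)
      (- (x ⬝ᵥ (M⁻¹ * B * M⁻¹) *ᵥ x)) 0 := by
  have hsm : ∀ i j, ContDiff ℝ ∞ fun r : ℝ => (M + r • B) i j := by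
    intro i j
    simp only [Matrix.add_apply, Matrix.smul_apply, smul_eq_mul]
    fun_prop
  have hopen : IsOpen {r : ℝ | (M + r • B).det ≠ 0} :=
    isOpen_ne_fun (det_smooth hsm).continuous continuous_const
  have h0 : (0:ℝ) ∈ {r : ℝ | (M + r • B).det ≠ 0} := by simpa using hM
  have hinv : ∀ i j, DifferentiableAt ℝ (fun r : ℝ => (M + r • B)⁻¹ i j) 0 := fun i j =>
    diffAt hopen (inv_smooth hsm (fun p hp => hp) i j) h0
  have hr : DifferentiableAt ℝ (fun r : ℝ => x ⬝ᵥ (M⁻¹ * B * (M + r • B)⁻¹) *ᵥ x) 0 := by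
    generalize M⁻¹ * B = C
    simp only [dotProduct, Matrix.mulVec, Matrix.mul_apply]
    exact DifferentiableAt.fun_sum fun i _ => DifferentiableAt.const_mul
      (DifferentiableAt.fun_sum fun j _ => DifferentiableAt.mul_const
        (DifferentiableAt.fun_sum fun l _ => (hinv l j).const_mul _) _) _
  have heq : (fun r : ℝ => x ⬝ᵥ (M + r • B)⁻¹ *ᵥ x) =ᶠ[nhds 0]
      fun r => x ⬝ᵥ M⁻¹ *ᵥ x - r * (x ⬝ᵥ (M⁻¹ * B * (M + r • B)⁻¹) *ᵥ x) := by
    refine Filter.eventuallyEq_of_mem (hopen.mem_nhds h0) fun r hr => ?_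
    have e1 : (M + r • B)⁻¹ = M⁻¹ - r • (M⁻¹ * B * (M + r • B)⁻¹) := by
      have e2 : M⁻¹ * (M + r • B) * (M + r • B)⁻¹ = M⁻¹ :=
        Matrix.mul_nonsing_inv_cancel_right _ _ (isUnit_iff_ne_zero.2 hr)
      rw [Matrix.mul_add, Matrix.nonsing_inv_mul _ (isUnit_iff_ne_zero.2 hM), Matrix.add_mul,
        Matrix.one_mul, Matrix.mul_smul, Matrix.smul_mul] at e2
      exact eq_sub_of_add_eq e2
    conv_lhs => rw [e1]
    rw [Matrix.sub_mulVec, dotProduct_sub, Matrix.smul_mulVec, dotProduct_smul, smul_eq_mul]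
  refine HasDerivAt.congr_of_eventuallyEq ?_ heq
  have := ((hasDerivAt_id (0:ℝ)).mul hr.hasDerivAt).const_sub (x ⬝ᵥ M⁻¹ *ᵥ x)
  refine this.congr_deriv ?_
  simp

lemma time_deriv (M B : Matrix (Fin d) (Fin d) ℝ) (hM : 0 < M.det) (x : Fin d → ℝ) :
    HasDerivAt (fun r : ℝ => gaussDensity (M + r • B) x)
      (1 / 2 * (gaussDensity M x * (x ⬝ᵥ (M⁻¹ * B * M⁻¹) *ᵥ x - (M⁻¹ * B).trace))) 0 := by
  have hpos : 0 < (2 * Real.pi) ^ d * M.det := mul_pos (by positivity) hM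
  have h1 := (det_deriv M B hM.ne').const_mul ((2 * Real.pi) ^ d)
  have h2 := (h1.sqrt (by simpa using hpos.ne')).inv (by simpa using (Real.sqrt_pos.2 hpos).ne')
  have h3 := ((quad_deriv M B hM.ne' x).const_mul (-(1/2))).exp
  have h4 := h2.mul h3
  unfold gaussDensity
  refine h4.congr_deriv ?_
  simp only [zero_smul, add_zero, Pi.inv_apply]
  set u := (2 * Real.pi) ^ d * M.det with hu
  have hs := Real.sqrt_pos.2 hpos
  have hsq := Real.sq_sqrt hpos.le
  have : (2 * Real.pi) ^ d * (M.det * (M⁻¹ * B).trace) = √u ^ 2 * (M⁻¹ * B).trace := by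
    rw [hsq, hu]; ring
  rw [this]
  field_simp
  ring

lemma space_deriv (M : Matrix (Fin d) (Fin d) ℝ) (hs : M.IsSymm) (x : Fin d → ℝ) (j : Fin d) :
    HasDerivAt (fun r : ℝ => gaussDensity M (x + r • Pi.single j 1))
      (- gaussDensity M x * (M⁻¹ *ᵥ x) j) 0 := by
  have hN : M⁻¹.IsSymm := by
    unfold Matrix.IsSymm; rw [Matrix.transpose_nonsing_inv, hs]
  have hq : ∀ r : ℝ, (x + r • Pi.single j 1) ⬝ᵥ M⁻¹ *ᵥ (x + r • Pi.single j 1) =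
      x ⬝ᵥ M⁻¹ *ᵥ x + (2 * (M⁻¹ *ᵥ x) j * r + M⁻¹ j j * r ^ 2) := by
    intro r
    have e1 : x ⬝ᵥ M⁻¹ *ᵥ (Pi.single j 1) = (M⁻¹ *ᵥ x) j := by
      rw [Matrix.dotProduct_mulVec, ← Matrix.mulVec_transpose, hN]; simp
    rw [Matrix.mulVec_add, Matrix.mulVec_smul, add_dotProduct, dotProduct_add, dotProduct_add,
      smul_dotProduct, smul_dotProduct, dotProduct_smul, dotProduct_smul, e1]
    simp
    ring
  unfold gaussDensity
  simp only [hq]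
  have h1 : HasDerivAt (fun r : ℝ => x ⬝ᵥ M⁻¹ *ᵥ x + (2 * (M⁻¹ *ᵥ x) j * r + M⁻¹ j j * r ^ 2))
      (2 * (M⁻¹ *ᵥ x) j) 0 := by
    have := ((((hasDerivAt_id (0:ℝ)).const_mul (2 * (M⁻¹ *ᵥ x) j)).add
      (((hasDerivAt_id (0:ℝ)).pow 2).const_mul (M⁻¹ j j)))).const_add (x ⬝ᵥ M⁻¹ *ᵥ x)
    refine this.congr_deriv ?_
    simp
  refine (((h1.const_mul (-(1/2))).exp).const_mul _).congr_deriv ?_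
  simp
  ring

lemma heat (A K : Matrix (Fin d) (Fin d) ℝ) (hA : A.IsSymm) (hK : K.IsSymm) :
    Set.EqOn (Dv (1, 0) (GG A K)) (fun p => (1/2) * Lp (A - K) (ee d) (GG A K) p)
      (UU A K ×ˢ Set.univ) := by
  have hV := V_open (d := d) (UU_open A K)
  have hsm := GG_smooth A K
  have hsym : ∀ s, (Gam A K s).IsSymm := fun s => by
    unfold Matrix.IsSymm Gam
    rw [Matrix.transpose_add, Matrix.transpose_smul, Matrix.transpose_smul, hA, hK]
  have h1 : ∀ j, Set.EqOn (Dv (ee d j) (GG A K))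
      (fun p => - GG A K p * ((Gam A K p.1)⁻¹ *ᵥ p.2) j) (UU A K ×ˢ Set.univ) := by
    intro j p hp
    refine Dv_eq (diffAt hV hsm hp) ?_
    have := space_deriv (Gam A K p.1) (hsym _) p.2 j
    simpa [GG, ee] using this
  have h2 : ∀ i j, Set.EqOn (Dv (ee d i) (Dv (ee d j) (GG A K)))
      (fun p => GG A K p * (((Gam A K p.1)⁻¹ *ᵥ p.2) i * ((Gam A K p.1)⁻¹ *ᵥ p.2) j
        - (Gam A K p.1)⁻¹ j i)) (UU A K ×ˢ Set.univ) := by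
    intro i j p hp
    rw [Dv_congr hV (h1 j) _ hp]
    refine Dv_eq ((diffAt hV (Dv_smooth hV hsm (ee d j)) hp).congr_of_eventuallyEq
      (Filter.eventuallyEq_of_mem (hV.mem_nhds hp) (h1 j).symm)) ?_
    have a1 := space_deriv (Gam A K p.1) (hsym _) p.2 i
    have a2 : HasDerivAt (fun r : ℝ => ((Gam A K p.1)⁻¹ *ᵥ p.2) j + r * (Gam A K p.1)⁻¹ j i)
        ((Gam A K p.1)⁻¹ j i) 0 := by
      simpa using ((hasDerivAt_id (0:ℝ)).mul_const ((Gam A K p.1)⁻¹ j i)).const_add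
        (((Gam A K p.1)⁻¹ *ᵥ p.2) j)
    have a3 := a1.neg.mul a2
    have a4 : (fun r : ℝ => -GG A K (p + r • ee d i) *
        ((Gam A K (p + r • ee d i).1)⁻¹ *ᵥ (p + r • ee d i).2) j) =
        (fun r : ℝ => -gaussDensity (Gam A K p.1) (p.2 + r • Pi.single i 1) *
          (((Gam A K p.1)⁻¹ *ᵥ p.2) j + r * (Gam A K p.1)⁻¹ j i)) := by
      funext r
      simp [GG, ee, Matrix.mulVec_add, Matrix.mulVec_smul]
    simp only [] 
    rw [a4]
    refine a3.congr_deriv ?_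
    simp [GG]
    ring
  intro p hp
  have ht : Dv (1, 0) (GG A K) p = 1 / 2 * (gaussDensity (Gam A K p.1) p.2 *
      (p.2 ⬝ᵥ ((Gam A K p.1)⁻¹ * (A - K) * (Gam A K p.1)⁻¹) *ᵥ p.2
        - ((Gam A K p.1)⁻¹ * (A - K)).trace)) := by
    refine Dv_eq (diffAt hV hsm hp) ?_
    have := time_deriv (Gam A K p.1) (A - K) hp.1 p.2
    simp only [← Gam_eq] at this
    convert this using 2
    simp [GG]
  rw [ht]
  simp only [Lp]
  congr 1
  have : ∀ q : Fin d × Fin d, (A - K) q.1 q.2 * Dv (ee d q.1) (Dv (ee d q.2) (GG A K)) p =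
      GG A K p * ((A - K) q.1 q.2 * (((Gam A K p.1)⁻¹ *ᵥ p.2) q.1 * ((Gam A K p.1)⁻¹ *ᵥ p.2) q.2)
        - (A - K) q.1 q.2 * (Gam A K p.1)⁻¹ q.2 q.1) := by
    intro q
    rw [h2 q.1 q.2 hp]; ring
  simp only [this, ← Finset.mul_sum]
  change gaussDensity (Gam A K p.1) p.2 * _ = gaussDensity (Gam A K p.1) p.2 * _
  congr 1
  rw [Finset.sum_sub_distrib]
  congr 1
  · have hN : (Gam A K p.1)⁻¹ᵀ = (Gam A K p.1)⁻¹ := by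
      rw [Matrix.transpose_nonsing_inv, hsym]
    rw [← Matrix.mulVec_mulVec, ← Matrix.mulVec_mulVec, Matrix.dotProduct_mulVec,
      ← Matrix.mulVec_transpose, hN]
    rw [Fintype.sum_prod_type]
    generalize (Gam A K p.1)⁻¹ *ᵥ p.2 = y
    generalize A - K = B
    simp only [dotProduct]
    refine Finset.sum_congr rfl fun i _ => ?_
    rw [Matrix.mulVec, dotProduct, Finset.mul_sum]
    refine Finset.sum_congr rfl fun j _ => ?_
    ring
  · rw [Matrix.trace_mul_comm, Matrix.trace, Fintype.sum_prod_type]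
    rfl

end heat

section pd
variable {d : ℕ}

lemma A_det_ne (A K : Matrix (Fin d) (Fin d) ℝ) (hK : K.PosDef)
    (hE : opNorm (A - K) ≤ lambdaMin K / 2) : A.det ≠ 0 := by
  intro h0
  obtain ⟨v, hv, hAv⟩ := Matrix.exists_mulVec_eq_zero_iff.2 h0
  have hs : 0 < ∑ i, v i ^ 2 := by
    obtain ⟨i, hi⟩ := Function.ne_iff.1 hv
    exact Finset.sum_pos' (fun i _ => sq_nonneg _) ⟨i, Finset.mem_univ _, by
      have : v i ≠ 0 := hi
      positivity⟩
  have hn : 0 < euclNorm v := Real.sqrt_pos.2 hs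
  set w : Fin d → ℝ := (euclNorm v)⁻¹ • v with hw
  have hAw : A *ᵥ w = 0 := by rw [hw, Matrix.mulVec_smul, hAv, smul_zero]
  have hw0 : w ≠ 0 := smul_ne_zero (inv_ne_zero hn.ne') hv
  have hw2 : ∑ i, w i ^ 2 = 1 := by
    simp only [hw, Pi.smul_apply, smul_eq_mul, mul_pow, ← Finset.mul_sum]
    rw [← Real.sq_sqrt hs.le]
    change (euclNorm v)⁻¹ ^ 2 * (euclNorm v) ^ 2 = 1
    field_simp
  have hw1 : euclNorm w = 1 := by rw [euclNorm, hw2, Real.sqrt_one]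
  have hKw : 0 < w ⬝ᵥ K *ᵥ w := by simpa using hK.dotProduct_mulVec_pos hw0
  have hl : lambdaMin K ≤ w ⬝ᵥ K *ᵥ w := by
    refine csInf_le ⟨0, ?_⟩ ⟨w, hw1, rfl⟩
    rintro r ⟨x, _, rfl⟩
    simpa using hK.posSemidef.dotProduct_mulVec_nonneg x
  have ho : euclNorm ((A - K) *ᵥ w) ≤ opNorm (A - K) := by
    refine le_csSup ⟨hsNorm (A - K), ?_⟩ ⟨w, hw1, rfl⟩
    rintro r ⟨x, hx, rfl⟩
    have hx2 : ∑ i, x i ^ 2 = 1 := by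
      rw [euclNorm, Real.sqrt_eq_one] at hx; exact hx
    refine Real.sqrt_le_sqrt (Finset.sum_le_sum fun i _ => ?_)
    have := Finset.sum_mul_sq_le_sq_mul_sq Finset.univ (fun j => (A - K) i j) x
    rw [hx2, mul_one] at this
    exact this
  have hneg : euclNorm ((A - K) *ᵥ w) = euclNorm (K *ᵥ w) := by
    rw [Matrix.sub_mulVec, hAw]; simp [euclNorm]
  have hcs : w ⬝ᵥ K *ᵥ w ≤ euclNorm (K *ᵥ w) := by
    refine Real.le_sqrt_of_sq_le ?_
    have := Finset.sum_mul_sq_le_sq_mul_sq Finset.univ w (K *ᵥ w)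
    rw [hw2, one_mul] at this
    exact this
  linarith

lemma Gam_posDef (A K : Matrix (Fin d) (Fin d) ℝ) (hA : A.PosSemidef) (hK : K.PosDef)
    (hE : opNorm (A - K) ≤ lambdaMin K / 2) {t : ℝ} (ht : t ∈ Set.Icc (0 : ℝ) 1) :
    0 < (Gam A K t).det := by
  rcases ht.2.lt_or_eq with h | h
  · have h1 : (t • A).PosSemidef := hA.smul ht.1
    have h2 : ((1 - t) • K).PosDef := hK.smul (by linarith)
    exact (Matrix.PosDef.posSemidef_add h1 h2).det_pos
  · subst h
    have : Gam A K 1 = A := by simp [Gam]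
    rw [this]
    exact lt_of_le_of_ne hA.det_nonneg (A_det_ne A K hK hE).symm

end pd

end St8

/-- identity `der_g_k`: explicit formula for `∂^k g/∂t^k` on the event `E`. -/
theorem statement_8
    {d : ℕ} (hd : 1 ≤ d)
    (A K : Matrix (Fin d) (Fin d) ℝ) (hA : A.PosSemidef) (hK : K.PosDef)
    (hE : opNorm (A - K) ≤ lambdaMin K / 2)
    (k : ℕ) (hk : 1 ≤ k) (t : ℝ) (ht : t ∈ Set.Icc (0 : ℝ) 1) (x : Fin d → ℝ) :
    iteratedDeriv k (fun s => gfun A K s x) t =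
      (1 / 2 ^ k : ℝ) *
        (∑ ι : Fin (2 * k) → Fin d,
          (∏ m : Fin k,
            (A - K) (ι ⟨2 * m.1, by have := m.2; omega⟩) (ι ⟨2 * m.1 + 1, by have := m.2; omega⟩)) *
          (mixedPartial (gaussDensity (Gam A K t)) (List.ofFn ι) x /
            gaussDensity (Gam A K t) x)) *
        gfun A K t x := by
  have hU : t ∈ St8.UU A K := St8.Gam_posDef A K hA hK hE ht
  have hAs : A.IsSymm := by simpa [Matrix.IsHermitian, Matrix.IsSymm] using hA.isHermitian
  have hKs : K.IsSymm := by simpa [Matrix.IsHermitian, Matrix.IsSymm] using hK.isHermitian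
  have key := St8.abstract_main (St8.UU_open A K) (A - K) (St8.GG_smooth A K)
    (St8.heat A K hAs hKs) k hU x
  have hpos : 0 < gaussDensity (Gam A K t) x := by
    have h1 : 0 < (2 * Real.pi) ^ d * (Gam A K t).det := mul_pos (by positivity) hU
    have h2 := Real.sqrt_pos.2 h1
    unfold gaussDensity
    positivity
  simp only [gfun]
  rw [iteratedDeriv_div_const]
  change iteratedDeriv k (fun s => St8.GG A K (s, x)) t / _ = _
  rw [key]
  simp only [mul_div_assoc', ← Finset.sum_div]
  change (1 / 2) ^ k * (∑ ι : Fin (2 * k) → Fin d, St8.coef (A - K) k ι *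
    mixedPartial (gaussDensity (Gam A K t)) (List.ofFn ι) x) / _ =
    (1 / 2 ^ k) * (∑ ι : Fin (2 * k) → Fin d, St8.coef (A - K) k ι *
    mixedPartial (gaussDensity (Gam A K t)) (List.ofFn ι) x) / gaussDensity (Gam A K t) x *
      gaussDensity (Gam A K t) x / _
  rw [div_mul_cancel₀ _ hpos.ne', _root_.one_div_pow]
end
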